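/- arXiv:2505.11400 — 3 statements merged into one kernel-verified Lean document; each statement's English description precedes it below -/
import Mathlib

section
/- Let k ≥ 3 and 1 ≤ ℓ ≤ k-1 be integers and let P be a k-uniform ℓ-path on n vertices. Set w₁ = k-1, wᵢ = ⌊k/(k-ℓ)⌋(k-ℓ) - 1 for 2 ≤ i ≤ k, and W = w₁ + w₂ + ⋯ + w_k. Then V(P) may be partitioned into sets U₁, …, U_k so that (a) for each i ∈ [k], every edge of P has precisely one vertex in Uᵢ, and (b) for each i ∈ [k], we have (wᵢ/W)n - 2 ≤ |Uᵢ| ≤ (wᵢ/W)n + 2. -/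
open Finset

/-- The edge set of the `k`-uniform `ℓ`-path whose vertex order is given by `vs`:
the `i`-th edge consists of the `k` consecutive vertices starting at position `i(k-ℓ)`. -/
def pathEdges {V : Type*} [DecidableEq V] (k ℓ : ℕ) (vs : List V) : Finset (Finset V) :=
  (Finset.range ((vs.length - ℓ) / (k - ℓ))).image
    (fun i => ((vs.drop (i * (k - ℓ))).take k).toFinset)

/-- `E` is (the edge set of) a `k`-uniform `ℓ`-path with vertex order `vs`. -/
def IsLPath {V : Type*} [DecidableEq V] (k ℓ : ℕ) (E : Finset (Finset V)) (vs : List V) :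
    Prop :=
  vs.Nodup ∧ (∃ m, 1 ≤ m ∧ vs.length = m * (k - ℓ) + ℓ) ∧ E = pathEdges k ℓ vs


lemma aux_card {V : Type*} [DecidableEq V] (vs : List V) (hn : vs.Nodup) (P : ℕ → Prop)
    [DecidablePred P] (a len : ℕ) (h : a + len ≤ vs.length) :
    ((((vs.drop a).take len).toFinset).filter (fun v => P (vs.idxOf v))).card + Nat.count P a
      = Nat.count P (a + len) := by
  rw [Nat.count_add, add_comm, Nat.count_eq_card_filter_range]
  congr 1
  rw [Nat.count_eq_card_filter_range]
  symm
  refine Finset.card_bij (fun p hp => vs[a + p]'(by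
    simp only [Finset.mem_filter, Finset.mem_range] at hp; omega)) ?_ ?_ ?_
  · intro p hp
    simp only [Finset.mem_filter, Finset.mem_range] at hp
    simp only [Finset.mem_filter, List.mem_toFinset, List.mem_iff_getElem]
    refine ⟨⟨p, ?_, ?_⟩, ?_⟩
    · simp; omega
    · simp
    · rw [hn.idxOf_getElem]; exact hp.2
  · intro p hp q hq hpq
    have := (hn.getElem_inj_iff).1 hpq
    omega
  · intro v hv
    simp only [Finset.mem_filter, List.mem_toFinset, List.mem_iff_getElem] at hv
    obtain ⟨⟨p, hp, rfl⟩, hv⟩ := hv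
    simp only [List.getElem_take, List.getElem_drop] at hv ⊢
    rw [hn.idxOf_getElem] at hv
    simp only [List.length_take, List.length_drop] at hp
    exact ⟨p, by simp only [Finset.mem_filter, Finset.mem_range]; exact ⟨by omega, hv⟩, rfl⟩

lemma aux_count0 (D n : ℕ) : Nat.count (fun p => D ∣ p + 1) n = n / D := by
  induction n with
  | zero => simp
  | succ n ih => rw [Nat.count_succ, ih, Nat.succ_div]

lemma aux_count1 (D n : ℕ) (Q : ℕ → Prop) [DecidablePred Q] :
    Nat.count (fun p => ¬ D ∣ p + 1 ∧ Q (p - p / D)) n = Nat.count Q (n - n / D) := by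
  induction n with
  | zero => simp
  | succ n ih =>
    rw [Nat.count_succ, ih, Nat.succ_div]
    by_cases h : D ∣ n + 1
    · simp [h]
    · have : n + 1 - (n / D + 0) = (n - n / D) + 1 := by
        have := Nat.div_le_self n D
        omega
      simp only [h, if_false, this, Nat.count_succ, not_false_eq_true, true_and]

lemma aux_div (d q r j : ℕ) (hr : r < d) (hq : 0 < q) :
    (j * d + (q * d + r)) / (q * d) = (j * d) / (q * d) + 1 := by
  have h1 : j * d + (q * d + r) = (j * d + r) + q * d := by ring
  have hd : 0 < d := by omega
  rw [h1, Nat.add_div_right _ (Nat.mul_pos hq hd)]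
  have h2 : (j * d + r) / (q * d) = (j * d) / (q * d) := by
    rw [mul_comm q d, ← Nat.div_div_eq_div_mul, ← Nat.div_div_eq_div_mul]
    congr 1
    rw [Nat.mul_div_cancel _ hd, mul_comm, Nat.mul_add_div hd, Nat.div_eq_of_lt hr]
    simp
  rw [h2]

/-- colour of a position -/
def aux_col (D r p : ℕ) : ℕ := if D ∣ p + 1 then 0 else (p - p / D) % r + 1

lemma aux_colcount0 (D r n : ℕ) : Nat.count (fun p => aux_col D r p = 0) n = n / D := by
  rw [← aux_count0]
  congr 1
  ext p
  unfold aux_col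
  split_ifs <;> simp_all

lemma aux_colcount1 (D r n i : ℕ) (hi : i < r) : Nat.count (fun p => aux_col D r p = i + 1) n
    = (n - n / D) / r + if i < (n - n / D) % r then 1 else 0 := by
  have h := Nat.count_modEq_card (n - n / D) (show 0 < r by omega) i
  rw [Nat.mod_eq_of_lt hi] at h
  rw [← h, ← aux_count1 D n (· ≡ i [MOD r])]
  congr 1
  ext p
  unfold aux_col Nat.ModEq
  rw [Nat.mod_eq_of_lt hi]
  split_ifs <;> simp_all

theorem statement7 {V : Type*} [DecidableEq V] (k ℓ : ℕ) (hk : 3 ≤ k) (hℓ1 : 1 ≤ ℓ)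
    (hℓ2 : ℓ ≤ k - 1) (E : Finset (Finset V)) (vs : List V) (hP : IsLPath k ℓ E vs)
    (w : Fin k → ℕ)
    (hw : ∀ i : Fin k, w i = if (i : ℕ) = 0 then k - 1 else k / (k - ℓ) * (k - ℓ) - 1)
    (W : ℕ) (hW : W = ∑ i, w i) :
    ∃ U : Fin k → Finset V,
      (∀ i j, i ≠ j → Disjoint (U i) (U j)) ∧
      Finset.univ.biUnion U = vs.toFinset ∧
      (∀ i, ∀ e ∈ E, (e ∩ U i).card = 1) ∧
      (∀ i, ((w i : ℝ) / (W : ℝ)) * (vs.length : ℝ) - 2 ≤ ((U i).card : ℝ) ∧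
        ((U i).card : ℝ) ≤ ((w i : ℝ) / (W : ℝ)) * (vs.length : ℝ) + 2) := by
  obtain ⟨hn, ⟨m, hm, hlen⟩, rfl⟩ := hP
  obtain ⟨d, hd⟩ : ∃ d, d = k - ℓ := ⟨_, rfl⟩
  have hd0 : 0 < d := by omega
  have hdk : d < k := by omega
  rw [← hd] at hw hlen
  obtain ⟨q, hq⟩ : ∃ q, q = k / d := ⟨_, rfl⟩
  have hq0 : 0 < q := by rw [hq]; exact Nat.div_pos hdk.le hd0
  rw [← hq] at hw
  have hkq : q * d + k % d = k := by rw [hq, mul_comm]; exact Nat.div_add_mod k d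
  have hrd : k % d < d := Nat.mod_lt _ hd0
  obtain ⟨D, hD⟩ : ∃ D, D = q * d := ⟨_, rfl⟩
  rw [← hD] at hw
  have hD2 : 2 ≤ D := by
    have : d ≤ D := by rw [hD]; exact Nat.le_mul_of_pos_left d hq0
    omega
  obtain ⟨r, rfl⟩ : ∃ r, k = r + 1 := ⟨k - 1, by omega⟩
  have hWr : W = r * D := by
    rw [hW, Fin.sum_univ_succ]
    simp only [hw]
    simp
    obtain ⟨e, rfl⟩ : ∃ e, D = e + 1 := ⟨D - 1, by omega⟩
    simp; ring
  have hcol : ∀ p, aux_col D r p < r + 1 := by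
    intro p
    unfold aux_col
    split_ifs
    · omega
    · have := Nat.mod_lt (p - p / D) (show 0 < r by omega); omega
  have hcard : ∀ i : Fin (r + 1),
      (vs.toFinset.filter (fun v => aux_col D r (vs.idxOf v) = i)).card
      = Nat.count (fun p => aux_col D r p = i) vs.length := by
    intro i
    have := aux_card vs hn (fun p => aux_col D r p = i) 0 vs.length (by omega)
    simpa using this
  refine ⟨fun i => vs.toFinset.filter (fun v => aux_col D r (vs.idxOf v) = i), ?_, ?_, ?_, ?_⟩
  · intro i j hij
    rw [Finset.disjoint_left]
    intro v hv hv'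
    simp only [Finset.mem_filter] at hv hv'
    exact hij (Fin.ext (hv.2.symm.trans hv'.2))
  · ext v
    simp only [Finset.mem_biUnion, Finset.mem_univ, true_and, Finset.mem_filter]
    exact ⟨fun ⟨_, h, _⟩ => h, fun h => ⟨⟨_, hcol _⟩, h, rfl⟩⟩
  · intro i e he
    unfold pathEdges at he
    simp only [Finset.mem_image, Finset.mem_range] at he
    obtain ⟨j, hj, rfl⟩ := he
    rw [← hd] at hj ⊢
    have hjm : j < m := by
      rw [hlen, Nat.add_sub_cancel, Nat.mul_div_cancel _ hd0] at hj; exact hj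
    have hle : j * d + (r + 1) ≤ vs.length := by
      have : (j + 1) * d ≤ m * d := Nat.mul_le_mul_right _ hjm
      rw [add_mul] at this
      omega
    have hset : ((vs.drop (j * d)).take (r + 1)).toFinset ∩
        vs.toFinset.filter (fun v => aux_col D r (vs.idxOf v) = i)
        = (((vs.drop (j * d)).take (r + 1)).toFinset).filter
          (fun v => aux_col D r (vs.idxOf v) = i) := by
      ext v
      simp only [Finset.mem_inter, Finset.mem_filter, List.mem_toFinset]
      exact ⟨fun h => ⟨h.1, h.2.2⟩,
        fun h => ⟨h.1, List.mem_of_mem_drop (List.mem_of_mem_take h.1), h.2⟩⟩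
    rw [hset]
    have hc := aux_card vs hn (fun p => aux_col D r p = i) (j * d) (r + 1) hle
    have hdiv := aux_div d q ((r + 1) % d) j hrd hq0
    rw [hkq, ← hD] at hdiv
    rcases i with ⟨_ | i, hi⟩
    · simp only [aux_colcount0] at hc ⊢
      omega
    · simp only [aux_colcount1 _ _ _ i (by omega : i < r)] at hc ⊢
      have h1 : j * d + (r + 1) - (j * d + (r + 1)) / D = (j * d - j * d / D) + r := by
        rw [hdiv]
        have := Nat.div_le_self (j * d) D
        omega
      rw [h1, Nat.add_mod_right, Nat.add_div_right _ (by omega)] at hc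
      omega
  · intro i
    simp only [hcard]
    generalize vs.length = n at *
    have hDR : (2 : ℝ) ≤ D := by exact_mod_cast hD2
    have hrR : (2 : ℝ) ≤ r := by exact_mod_cast (by omega : 2 ≤ r)
    have hA1 : ((n / D : ℕ) : ℝ) ≤ (n : ℝ) / D := Nat.cast_div_le
    have hA2 : (n : ℝ) / D < ((n / D : ℕ) : ℝ) + 1 := by
      rw [div_lt_iff₀ (by linarith)]
      exact_mod_cast Nat.lt_mul_of_div_lt (Nat.lt_succ_self (n / D)) (by omega : 0 < D)
    rcases i with ⟨_ | i, hi⟩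
    · have : ((w ⟨0, hi⟩ : ℕ) : ℝ) / W * n = n / D := by
        rw [hw, hWr]; simp; field_simp
      rw [this, aux_colcount0]
      constructor <;> linarith
    · have hwi : ((w ⟨i + 1, hi⟩ : ℕ) : ℝ) / W * n = (n - n / D) / r := by
        rw [hw, hWr]; simp
        rw [Nat.cast_sub (by omega)]; push_cast; field_simp
      rw [hwi, aux_colcount1 _ _ _ i (by omega)]
      have hM : ((n - n / D : ℕ) : ℝ) = n - (n / D : ℕ) := Nat.cast_sub (Nat.div_le_self _ _)
      generalize n - n / D = M at *
      generalize n / D = A at *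
      have hB1 : ((M / r : ℕ) : ℝ) ≤ (M : ℝ) / r := Nat.cast_div_le
      have hB2 : (M : ℝ) / r < ((M / r : ℕ) : ℝ) + 1 := by
        rw [div_lt_iff₀ (by linarith)]
        exact_mod_cast Nat.lt_mul_of_div_lt (Nat.lt_succ_self (M / r)) (by omega : 0 < r)
      have h3 : ((n : ℝ) - n / D) / r ≤ (M : ℝ) / r := by
        gcongr; linarith
      have h4 : (M : ℝ) / r ≤ ((n : ℝ) - n / D) / r + 1 := by
        rw [div_add_one (by linarith)]
        gcongr; linarith
      push_cast
      split_ifs <;> push_cast <;> constructor <;> linarith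
end

section
/- Fix integers k ≥ 3 and 1 ≤ ℓ ≤ k-1 and a real α > 0 (with α sufficiently small in terms of k). Then there exist β₀ > 0 and, for each 0 < β < β₀, an integer n₀ such that the following holds. If H is a k-graph on n ≥ n₀ vertices with δ⁺(H) ≥ (1 - 1/⌈k/(k-ℓ)⌉)·n + αn and H has no isolated vertices, then there exist a set A ⊆ V(H) with |A| ≤ βn and distinct ordered ℓ-tuples x, y of vertices of H with the property that for every set S ⊆ V(H)∖A with |S| ≤ β²n and k-ℓ dividing |S|, there is an ℓ-path in H with vertex set A ∪ S and with ends x and y. -/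
open Finset

/-- The degree of a vertex set `S` in the `k`-graph with edge set `E`. -/
def degH {V : Type*} [DecidableEq V] (E : Finset (Finset V)) (S : Finset V) : ℕ :=
  (E.filter (fun e => S ⊆ e)).card

/-- The minimum positive codegree `δ⁺`: the minimum of `deg(S)` over all
`(k-1)`-element vertex sets `S` with `deg(S) ≥ 1`. -/
noncomputable def posCodeg {V : Type*} [DecidableEq V] (k : ℕ) (E : Finset (Finset V)) : ℕ :=
  sInf {d : ℕ | ∃ S : Finset V, S.card = k - 1 ∧ 1 ≤ degH E S ∧ degH E S = d}

/-- `vs` is the vertex order of a `k`-uniform `ℓ`-path all of whose edges are edges of `E`,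
i.e. an `ℓ`-path in the `k`-graph `E`. -/
def IsLPathIn {V : Type*} [DecidableEq V] (k ℓ : ℕ) (E : Finset (Finset V)) (vs : List V) :
    Prop :=
  vs.Nodup ∧ (∃ m, 1 ≤ m ∧ vs.length = m * (k - ℓ) + ℓ) ∧ pathEdges k ℓ vs ⊆ E

/-- Every `j` consecutive entries of `L` form a set satisfying `F`. -/
def Tight {V : Type*} [DecidableEq V] (j : ℕ) (F : Finset V → Prop) (L : List V) : Prop :=
  ∀ s W t : List V, L = s ++ W ++ t → W.length = j → F W.toFinset

lemma Tight.mono_infix {V : Type*} [DecidableEq V] {j : ℕ} {F : Finset V → Prop} {L M : List V}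
    (h : Tight j F L) (a b : List V) (hL : L = a ++ M ++ b) : Tight j F M := by
  intro s W t hM hW
  exact h (a ++ s) W (t ++ b) (by subst hM; simp [hL]) hW

lemma Tight.comp {V : Type*} [DecidableEq V] {j : ℕ} {F : Finset V → Prop} {Z c R : List V}
    (h1 : Tight j F (Z ++ c)) (h2 : Tight j F (c ++ R)) (hc : j ≤ c.length + 1) :
    Tight j F (Z ++ c ++ R) := by
  intro s W t hE hW
  by_cases hs : Z.length ≤ s.length
  · have h3 : Z <+: s := by
      apply List.prefix_of_prefix_length_le (l₃ := Z ++ c ++ R) _ _ hs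
      · exact ⟨c ++ R, by simp⟩
      · exact ⟨W ++ t, by simp [hE]⟩
    obtain ⟨s', rfl⟩ := h3
    refine h2 s' W t ?_ hW
    simpa using hE
  · have h3 : s ++ W <+: Z ++ c := by
      apply List.prefix_of_prefix_length_le (l₃ := Z ++ c ++ R)
      · exact ⟨t, by simp [hE]⟩
      · exact ⟨R, by simp⟩
      · simp; omega
    obtain ⟨t', ht'⟩ := h3
    exact h1 s W t' ht'.symm hW

lemma Tight.snoc {V : Type*} [DecidableEq V] {j : ℕ} {F : Finset V → Prop} {M : List V} {u : V}
    (h1 : Tight j F M) (D M' : List V) (hM : M = M' ++ D) (hD : D.length + 1 = j)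
    (hF : F (insert u D.toFinset)) : Tight j F (M ++ [u]) := by
  subst hM
  refine h1.comp ?_ (by omega)
  intro s W t hE hW
  have hl := congrArg List.length hE
  simp at hl
  have hs : s = [] := List.length_eq_zero_iff.1 (by omega)
  have ht : t = [] := List.length_eq_zero_iff.1 (by omega)
  subst hs ht
  simp at hE
  subst hE
  have : (D ++ [u]).toFinset = insert u D.toFinset := by ext; simp
  rwa [this]

/-- Inserting `v` between `x` and `y`. -/
lemma Tight.insert_mid {V : Type*} [DecidableEq V] {k : ℕ} {F : Finset V → Prop}
    {c x y : List V} {v : V} (hk : 1 ≤ k)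
    (h1 : Tight k F (c ++ (x ++ y))) (h2 : Tight (k - 1) (fun W => F (insert v W)) (x ++ y))
    (hx : x.length = k - 1) :
    Tight k F (c ++ (x ++ v :: y)) := by
  have hcx : Tight k F (c ++ x) := h1.mono_infix [] y (by simp)
  have hy : Tight k F y := h1.mono_infix (c ++ x) [] (by simp)
  have key : Tight k F (x ++ v :: y) := by
    intro s W t hE hW
    rw [List.append_assoc] at hE
    obtain ⟨a, rfl, ha⟩ | ⟨a, rfl, ha⟩ := List.append_eq_append_iff.1 hE
    · -- s = x ++ a
      cases a with
      | nil =>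
        simp at ha
        cases W with
        | nil => simp at hW; omega
        | cons w W =>
          simp at ha
          obtain ⟨rfl, rfl⟩ := ha
          have := h2 x W t (by simp) (by simp at hW; omega)
          simpa using this
      | cons a0 a =>
        simp at ha
        exact hy a W t (by simp [ha.2]) hW
    · -- x = s ++ a
      obtain ⟨d, rfl, hd⟩ | ⟨d, rfl, hd⟩ := List.append_eq_append_iff.1 ha
      · simp at hx; omega
      · cases d with
        | nil => simp at hx hW; omega
        | cons d0 d =>
          simp at hd
          obtain ⟨rfl, rfl⟩ := hd
          have := h2 s (a ++ d) t (by simp) (by simp at hW ⊢; omega)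
          have e : (a ++ v :: d).toFinset = insert v (a ++ d).toFinset := by ext; simp
          rwa [e]
  have := Tight.comp hcx key (by omega)
  simpa using this

/-- A tree in which every node has at least `q` children has at least `q ^ m` nodes at level
`m`. -/
lemma tree_count {V : Type*} [DecidableEq V] (P : List V → Prop) (q m : ℕ)
    (h0 : P []) (hs : ∀ l, P l → l.length < m →
      ∃ C : Finset V, q ≤ C.card ∧ ∀ u ∈ C, P (l ++ [u])) :
    ∃ F : Finset (List V), q ^ m ≤ F.card ∧ ∀ l ∈ F, l.length = m ∧ P l := by
  suffices ∀ j ≤ m, ∃ F : Finset (List V), q ^ j ≤ F.card ∧ ∀ l ∈ F, l.length = j ∧ P l from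
    this m le_rfl
  intro j
  induction j with
  | zero => intro _; exact ⟨{[]}, by simp, by simp [h0]⟩
  | succ j ih =>
    intro hj
    obtain ⟨F, hF, hF2⟩ := ih (by omega)
    have : ∀ l : List V, ∃ C : Finset V, l ∈ F → q ≤ C.card ∧ ∀ u ∈ C, P (l ++ [u]) := by
      intro l
      by_cases hl : l ∈ F
      · obtain ⟨C, hC⟩ := hs l (hF2 l hl).2 (by have := (hF2 l hl).1; omega)
        exact ⟨C, fun _ => hC⟩
      · exact ⟨∅, fun h => absurd h hl⟩
    choose C hC using this
    refine ⟨F.biUnion (fun l => (C l).image (fun u => l ++ [u])), ?_, ?_⟩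
    · rw [Finset.card_biUnion]
      · calc q ^ (j + 1) = q ^ j * q := pow_succ _ _
          _ ≤ F.card * q := Nat.mul_le_mul_right _ hF
          _ = ∑ l ∈ F, q := by simp
          _ ≤ _ := by
            apply Finset.sum_le_sum
            intro l hl
            rw [Finset.card_image_of_injective _ (by intro a b h; simpa using h)]
            exact (hC l hl).1
      · intro a ha b hb hab
        change Disjoint _ _
        rw [Finset.disjoint_left]
        intro w hw1 hw2
        simp only [Finset.mem_image] at hw1 hw2
        obtain ⟨u, _, rfl⟩ := hw1
        obtain ⟨u', _, h'⟩ := hw2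
        exact hab (List.append_inj_left' h' rfl).symm
    · intro l hl
      simp only [Finset.mem_biUnion, Finset.mem_image] at hl
      obtain ⟨l', hl', u, hu, rfl⟩ := hl
      exact ⟨by simp [(hF2 l' hl').1], (hC l' hl').2 u hu⟩

lemma nbhd_card {V : Type*} [DecidableEq V] [Fintype V] (k : ℕ) (hk : 1 ≤ k)
    (E : Finset (Finset V)) (hE : ∀ e ∈ E, e.card = k) (S : Finset V) (d : V)
    (hd : insert d S ∈ E) (hS : d ∉ S) :
    posCodeg k E ≤ (univ.filter (fun u => insert u S ∈ E ∧ u ∉ S)).card := by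
  have hc : S.card = k - 1 := by
    have := hE _ hd
    rw [Finset.card_insert_of_notMem hS] at this
    omega
  have h1 : posCodeg k E ≤ degH E S := by
    apply Nat.sInf_le
    refine ⟨S, hc, ?_, rfl⟩
    apply Finset.card_pos.2
    exact ⟨insert d S, by simp [hd]⟩
  refine h1.trans ?_
  refine (Finset.card_le_card (t := (univ.filter (fun u => insert u S ∈ E ∧ u ∉ S)).image
    (fun u => insert u S)) ?_).trans Finset.card_image_le
  intro e he
  rw [Finset.mem_filter] at he
  have : ∃ a ∉ S, insert a S = e := by
    rw [Finset.exists_eq_insert_iff]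
    exact ⟨he.2, by rw [hc, hE e he.1]; omega⟩
  obtain ⟨a, ha, rfl⟩ := this
  exact Finset.mem_image.2 ⟨a, by simp [ha, he.1], rfl⟩

/-- Two common extensions. -/
lemma common_ext {V : Type*} [DecidableEq V] [Fintype V] (k : ℕ) (hk : 1 ≤ k)
    (E : Finset (Finset V)) (hE : ∀ e ∈ E, e.card = k) (S S' U : Finset V) (d d' : V)
    (hd : insert d S ∈ E) (hS : d ∉ S) (hd' : insert d' S' ∈ E) (hS' : d' ∉ S') (q : ℕ)
    (hq : q + U.card + Fintype.card V ≤ 2 * posCodeg k E) :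
    ∃ C : Finset V, q ≤ C.card ∧ ∀ u ∈ C, u ∉ U ∧ insert u S ∈ E ∧ insert u S' ∈ E := by
  have h1 := nbhd_card k hk E hE S d hd hS
  have h2 := nbhd_card k hk E hE S' d' hd' hS'
  set A := univ.filter (fun u => insert u S ∈ E ∧ u ∉ S)
  set B := univ.filter (fun u => insert u S' ∈ E ∧ u ∉ S')
  refine ⟨(A ∩ B) \ U, ?_, ?_⟩
  · have := Finset.card_union_add_card_inter A B
    have h3 := Finset.card_le_univ (A ∪ B)
    have h4 := Finset.le_card_sdiff U (A ∩ B)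
    omega
  · intro u hu
    simp [A, B] at hu
    tauto

/-- Number of absorbing units for `v`. -/
lemma unit_count {V : Type*} [DecidableEq V] [Fintype V] (k : ℕ) (hk : 3 ≤ k)
    (E : Finset (Finset V)) (hE : ∀ e ∈ E, e.card = k) (c : List V) (hc : c.length = k)
    (hcE : c.toFinset ∈ E) (U : Finset V) (v : V) (hv : 1 ≤ degH E {v}) (q m : ℕ)
    (hq : q + (U.card + 1 + m) + Fintype.card V ≤ 2 * posCodeg k E) :
    ∃ F : Finset (List V), q ^ m ≤ F.card ∧ ∀ l ∈ F, l.length = m ∧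
      (l.Nodup ∧ v ∉ l ∧ (∀ u ∈ l, u ∉ U) ∧ Tight k (· ∈ E) (c ++ l) ∧
        Tight (k - 1) (fun W => insert v W ∈ E) l) := by
  obtain ⟨f, hf⟩ := Finset.card_pos.1 (show 0 < (E.filter (fun e => {v} ⊆ e)).card from hv)
  simp at hf
  obtain ⟨b, hb⟩ : ∃ b : List V, b = (f.erase v).toList := ⟨_, rfl⟩
  have hbl : b.length = k - 1 := by
    simp [hb, Finset.card_erase_of_mem hf.2, hE f hf.1]
  have hbf : insert v b.toFinset = f := by simp [hb, Finset.insert_erase hf.2]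
  have T0 : ∀ (j : ℕ) (F : Finset V → Prop) (L : List V), L.length = j → F L.toFinset →
      Tight j F L := by
    intro j F L hL hF s W t h hW
    have hl := congrArg List.length h
    simp at hl
    have hs : s = [] := List.length_eq_zero_iff.1 (by omega)
    have ht : t = [] := List.length_eq_zero_iff.1 (by omega)
    subst hs ht
    simp at h
    rwa [← h]
  have main := tree_count (fun l : List V => l.Nodup ∧ v ∉ l ∧ (∀ u ∈ l, u ∉ U) ∧
    Tight k (· ∈ E) (c ++ l) ∧ Tight (k - 1) (fun W => insert v W ∈ E) (b ++ l)) q m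
    ⟨by simp, by simp, by simp, by simpa using T0 k _ c hc hcE,
      by simpa using T0 (k-1) _ b hbl (by simpa [hbf] using hf.1)⟩ ?_
  · obtain ⟨F, hF, hF2⟩ := main
    refine ⟨F, hF, fun l hl => ?_⟩
    obtain ⟨h1, h2, h3, h4, h5, h6⟩ := hF2 l hl
    exact ⟨h1, h2, h3, h4, h5, h6.mono_infix b [] (by simp)⟩
  · rintro l ⟨hn, hvl, hlU, hT1, hT2⟩ hlm
    have split : ∀ (M : List V) (j : ℕ), j + 1 ≤ M.length →
        ∃ M' d D, M = M' ++ d :: D ∧ D.length = j := by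
      intro M j hj
      have hlen : (M.drop (M.length - (j+1))).length = j + 1 := by simp; omega
      cases hD : M.drop (M.length - (j+1)) with
      | nil => simp [hD] at hlen
      | cons d D =>
        refine ⟨M.take (M.length - (j+1)), d, D, ?_, ?_⟩
        · rw [← hD, List.take_append_drop]
        · simpa [hD] using hlen
    obtain ⟨M1, d1, D1, hM1, hD1⟩ := split (c ++ l) (k - 1) (by simp; omega)
    obtain ⟨M2, d2, D2, hM2, hD2⟩ := split (b ++ l) (k - 2) (by simp; omega)
    have e1 : (d1 :: D1).toFinset ∈ E := hT1 M1 (d1 :: D1) [] (by simp [hM1]) (by simp; omega)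
    have e2 : insert v (d2 :: D2).toFinset ∈ E :=
      hT2 M2 (d2 :: D2) [] (by simp [hM2]) (by simp; omega)
    simp only [List.toFinset_cons] at e1 e2
    have n1 : d1 ∉ D1.toFinset := by
      intro h
      have h' := hE _ e1
      rw [Finset.insert_eq_of_mem h] at h'
      have := List.toFinset_card_le D1
      omega
    rw [Finset.insert_comm] at e2
    have n2 : d2 ∉ insert v D2.toFinset := by
      intro h
      have h' := hE _ e2
      rw [Finset.insert_eq_of_mem h] at h'
      have := List.toFinset_card_le D2
      have := Finset.card_insert_le v D2.toFinset
      omega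
    obtain ⟨C, hC, hC2⟩ := common_ext k (by omega) E hE _ _ (insert v (U ∪ l.toFinset)) d1 d2
      e1 n1 e2 n2 q (by
        have := List.toFinset_card_le l
        have := Finset.card_insert_le v (U ∪ l.toFinset)
        have := Finset.card_union_le U l.toFinset
        omega)
    refine ⟨C, hC, fun u hu => ?_⟩
    obtain ⟨hu1, hu2, hu3⟩ := hC2 u hu
    simp only [Finset.mem_insert, Finset.mem_union, List.mem_toFinset, not_or] at hu1
    refine ⟨?_, ?_, ?_, ?_, ?_⟩
    · rw [List.nodup_append]
      refine ⟨hn, by simp, ?_⟩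
      intro a ha b hb
      simp at hb
      subst hb
      rintro rfl
      exact hu1.2.2 ha
    · simp [hvl, Ne.symm hu1.1]
    · intro a ha
      simp at ha
      rcases ha with ha | rfl
      · exact hlU a ha
      · exact hu1.2.1
    · rw [← List.append_assoc]
      exact hT1.snoc D1 (M1 ++ [d1]) (by simp [hM1]) (by omega) hu2
    · rw [← List.append_assoc]
      exact hT2.snoc D2 (M2 ++ [d2]) (by simp [hM2]) (by omega)
        (by rw [Finset.insert_comm]; exact hu3)

/-- Choosing one unit that serves many vertices (with respect to weights). -/
lemma unit_exists {V : Type*} [DecidableEq V] [Fintype V] (k : ℕ) (hk : 3 ≤ k)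
    (E : Finset (Finset V)) (hE : ∀ e ∈ E, e.card = k) (hiso : ∀ v, 1 ≤ degH E {v})
    (c : List V) (hc : c.length = k)
    (hcE : c.toFinset ∈ E) (U : Finset V) (w : V → ℝ) (hw : ∀ v, 0 < w v)
    (hU : ∃ v, v ∉ U) (q : ℕ) (p : ℝ) (hp : 0 < p)
    (hpq : p * (Fintype.card V : ℝ) ^ (2 * k - 1) ≤ (q : ℝ) ^ (2 * k - 1))
    (hq : q + (U.card + 1 + (2 * k - 1)) + Fintype.card V ≤ 2 * posCodeg k E) :
    ∃ (x y : List V) (G : Finset V), x.length = k - 1 ∧ y.length = k ∧ (x ++ y).Nodup ∧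
      (∀ u ∈ x ++ y, u ∉ U) ∧ Tight k (· ∈ E) (c ++ (x ++ y)) ∧ G ⊆ Uᶜ ∧
      (∀ v ∈ G, v ∉ x ++ y ∧ Tight k (· ∈ E) (c ++ (x ++ v :: y))) ∧
      p * ∑ v ∈ Uᶜ, w v ≤ ∑ v ∈ G, w v := by
  classical
  set m := 2 * k - 1 with hm
  let good : List V → V → Prop := fun l v =>
      (l.Nodup ∧ v ∉ l ∧ (∀ u ∈ l, u ∉ U) ∧ Tight k (· ∈ E) (c ++ l) ∧
        Tight (k - 1) (fun W => insert v W ∈ E) l)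
  let A : Finset (List V) := univ.image (fun f : Fin m → V => List.ofFn f)
  have hA : (A.card : ℝ) ≤ (Fintype.card V : ℝ) ^ m := by
    have : A.card ≤ Fintype.card V ^ m := by
      refine Finset.card_image_le.trans ?_
      simp
    exact_mod_cast this
  have hAm : ∀ l : List V, l.length = m → l ∈ A := by
    intro l hl
    refine Finset.mem_image.2 ⟨fun i => l.get (i.cast hl.symm), by simp, ?_⟩
    exact List.ext_getElem (by simp [hl]) (by simp)
  have hAl : ∀ l ∈ A, l.length = m := by
    intro l hl
    obtain ⟨f, _, rfl⟩ := Finset.mem_image.1 hl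
    simp
  have hcnt : ∀ v, (q : ℝ) ^ m ≤ ((A.filter (fun l => good l v)).card : ℝ) := by
    intro v
    obtain ⟨F, hF, hF2⟩ := unit_count k hk E hE c hc hcE U v (hiso v) q m hq
    have : F ⊆ A.filter (fun l => good l v) := by
      intro l hl
      exact Finset.mem_filter.2 ⟨hAm l (hF2 l hl).1, (hF2 l hl).2⟩
    exact_mod_cast hF.trans (Finset.card_le_card this)
  set W := ∑ v ∈ Uᶜ, w v with hW
  have hWpos : 0 < W := by
    obtain ⟨v, hv⟩ := hU
    exact Finset.sum_pos (fun v _ => hw v) ⟨v, by simpa using hv⟩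
  have hsum : ∑ l ∈ A, p * W ≤ ∑ l ∈ A, ∑ v ∈ Uᶜ.filter (fun v => good l v), w v := by
    calc ∑ l ∈ A, p * W = A.card * (p * W) := by simp
      _ ≤ (Fintype.card V : ℝ) ^ m * (p * W) := by gcongr
      _ = (p * (Fintype.card V : ℝ) ^ m) * W := by ring
      _ ≤ (q : ℝ) ^ m * W := by gcongr
      _ = ∑ v ∈ Uᶜ, (q : ℝ) ^ m * w v := by rw [hW, Finset.mul_sum]
      _ ≤ ∑ v ∈ Uᶜ, ((A.filter (fun l => good l v)).card : ℝ) * w v := by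
        apply Finset.sum_le_sum
        intro v _
        exact mul_le_mul_of_nonneg_right (hcnt v) (hw v).le
      _ = ∑ v ∈ Uᶜ, ∑ l ∈ A, if good l v then w v else 0 := by
        apply Finset.sum_congr rfl
        intro v _
        rw [← Finset.sum_filter]
        simp
      _ = ∑ l ∈ A, ∑ v ∈ Uᶜ, if good l v then w v else 0 := Finset.sum_comm
      _ = _ := by
        apply Finset.sum_congr rfl
        intro l _
        rw [← Finset.sum_filter]
  have hAne : A.Nonempty := by
    obtain ⟨v, hv⟩ := hU
    exact ⟨List.replicate m v, hAm _ (by simp)⟩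
  obtain ⟨l, hlA, hl⟩ := Finset.exists_le_of_sum_le hAne hsum
  have hGne : (Uᶜ.filter (fun v => good l v)).Nonempty := by
    by_contra h
    rw [Finset.not_nonempty_iff_eq_empty] at h
    rw [h] at hl
    simp at hl
    have := mul_pos hp hWpos
    linarith
  obtain ⟨v0, hv0⟩ := hGne
  obtain ⟨g1, g2, g3, g4, g5⟩ := (Finset.mem_filter.1 hv0).2
  have hlen := hAl l hlA
  have hxl : (l.take (k-1)).length = k - 1 := by simp; omega
  refine ⟨l.take (k - 1), l.drop (k - 1), Uᶜ.filter (fun v => good l v), hxl,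
    by simp; omega, by simpa using g1, by simpa using g3, by simpa using g4,
    Finset.filter_subset _ _, ?_, hl⟩
  intro v hv
  obtain ⟨g1, g2, g3, g4, g5⟩ := (Finset.mem_filter.1 hv).2
  refine ⟨by simpa using g2, ?_⟩
  exact Tight.insert_mid (by omega) (by simpa using g4) (by simpa using g5) hxl

/-- The absorbing path, built unit by unit. -/
lemma build {V : Type*} [DecidableEq V] [Fintype V] (k : ℕ) (hk : 3 ≤ k)
    (E : Finset (Finset V)) (hE : ∀ e ∈ E, e.card = k) (hiso : ∀ v, 1 ≤ degH E {v})
    (base : List V) (hb : base.length = k) (hbn : base.Nodup) (hbE : base.toFinset ∈ E)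
    (q : ℕ) (p : ℝ) (hp : 0 < p) (hp1 : p ≤ 1)
    (hpq : p * (Fintype.card V : ℝ) ^ (2 * k - 1) ≤ (q : ℝ) ^ (2 * k - 1)) (N₀ : ℕ)
    (hq : q + (k + (2 * k - 1) * N₀ + 1 + (2 * k - 1)) + Fintype.card V ≤ 2 * posCodeg k E)
    (hcard : k + (2 * k - 1) * N₀ < Fintype.card V) :
    ∀ N ≤ N₀, ∃ (c : List V) (U : Finset V) (G : ℕ → Finset V), c.length = k ∧
      c.toFinset ∈ E ∧ U.card = k + (2 * k - 1) * N ∧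
      ∑ v ∈ Uᶜ, (1 / 2 : ℝ) ^ ((range N).filter (fun i => v ∈ G i)).card
        ≤ Fintype.card V * (1 - p / 2) ^ N ∧
      ∀ (S : Finset V) (h : V → ℕ), (∀ v ∈ S, h v < N ∧ v ∈ G (h v)) → Set.InjOn h S →
        Disjoint S U → ∃ Z, Tight k (· ∈ E) (Z ++ c) ∧ (Z ++ c).Nodup ∧
          (Z ++ c).toFinset = U ∪ S ∧ base <+: Z ++ c := by
  intro N
  induction N with
  | zero =>
    intro _
    refine ⟨base, base.toFinset, fun _ => ∅, hb, hbE, ?_, ?_, ?_⟩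
    · rw [List.toFinset_card_of_nodup hbn, hb]; simp
    · simp
      exact Finset.card_le_univ _
    · intro S h hS _ _
      have : S = ∅ := by
        rw [Finset.eq_empty_iff_forall_notMem]
        intro v hv
        have := (hS v hv).1
        omega
      subst this
      refine ⟨[], ?_, by simpa using hbn, by simp, by simp⟩
      intro s W t h hW
      have hl := congrArg List.length h
      simp at hl
      have hs : s = [] := List.length_eq_zero_iff.1 (by omega)
      have ht : t = [] := List.length_eq_zero_iff.1 (by omega)
      subst hs ht
      simp at h
      rwa [← h]
  | succ N ih =>
    intro hN
    obtain ⟨c, U, G, hc, hcE, hUc, hpot, habs⟩ := ih (by omega)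
    have hmul : (2 * k - 1) * N ≤ (2 * k - 1) * N₀ := Nat.mul_le_mul_left _ (by omega)
    obtain ⟨x, y, G', hx, hy, hn, hxyU, hT, hG', hG'2, hsum⟩ := unit_exists k hk E hE hiso c hc
      hcE U (fun v => (1 / 2 : ℝ) ^ ((range N).filter (fun i => v ∈ G i)).card)
      (fun v => by positivity) (by
        by_contra h
        push Not at h
        have : U = univ := Finset.eq_univ_of_forall h
        rw [this, Finset.card_univ] at hUc
        omega) q p hp hpq (by omega)
    set w : V → ℝ := fun v => (1 / 2 : ℝ) ^ ((range N).filter (fun i => v ∈ G i)).card with hw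
    have hdisj : Disjoint U (x ++ y).toFinset := by
      rw [Finset.disjoint_right]
      intro u hu
      exact hxyU u (List.mem_toFinset.1 hu)
    refine ⟨y, U ∪ (x ++ y).toFinset, fun i => if i = N then G' else G i, hy, ?_, ?_, ?_, ?_⟩
    · exact hT (c ++ x) y [] (by simp) hy
    · rw [Finset.card_union_of_disjoint hdisj, List.toFinset_card_of_nodup hn, hUc,
        List.length_append, hx, hy, Nat.mul_succ]
      clear ih habs
      omega
    · have hcnt : ∀ v, (1 / 2 : ℝ) ^ ((range (N + 1)).filter
          (fun i => v ∈ if i = N then G' else G i)).card = w v - if v ∈ G' then w v / 2 else 0 := by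
        intro v
        have e : (range N).filter (fun i => v ∈ if i = N then G' else G i) =
            (range N).filter (fun i => v ∈ G i) := by
          apply Finset.filter_congr
          intro i hi
          rw [if_neg (by have := Finset.mem_range.1 hi; omega)]
        rw [Finset.range_add_one, Finset.filter_insert, e]
        by_cases hv : v ∈ G'
        · simp only [hv, if_true]
          rw [Finset.card_insert_of_notMem (by simp), pow_succ]
          simp only [hw]
          ring
        · simp [hv, hw]
      calc _ = ∑ v ∈ (U ∪ (x ++ y).toFinset)ᶜ, (w v - if v ∈ G' then w v / 2 else 0) :=
            Finset.sum_congr rfl (fun v _ => hcnt v)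
        _ ≤ ∑ v ∈ Uᶜ, (w v - if v ∈ G' then w v / 2 else 0) := by
            apply Finset.sum_le_sum_of_subset_of_nonneg
            · apply Finset.compl_subset_compl.2 Finset.subset_union_left
            · intro v _ _
              rw [← hcnt]
              positivity
        _ = ∑ v ∈ Uᶜ, w v - (∑ v ∈ G', w v) / 2 := by
            rw [Finset.sum_sub_distrib, ← Finset.sum_filter, Finset.sum_div]
            congr 2
            ext v
            simp only [Finset.mem_filter]
            exact ⟨fun h => h.2, fun h => ⟨hG' h, h⟩⟩
        _ ≤ (1 - p / 2) * ∑ v ∈ Uᶜ, w v := by linarith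
        _ ≤ (1 - p / 2) * (Fintype.card V * (1 - p / 2) ^ N) :=
            mul_le_mul_of_nonneg_left hpot (by linarith)
        _ = _ := by ring
    · intro S h hS hinj hSU
      rw [Finset.disjoint_union_right] at hSU
      by_cases hex : ∃ v ∈ S, h v = N
      · obtain ⟨v, hv, hvN⟩ := hex
        have hvG : v ∈ G' := by simpa [hvN] using (hS v hv).2
        obtain ⟨hvxy, hTv⟩ := hG'2 v hvG
        obtain ⟨Z, hZT, hZn, hZU, hZb⟩ := habs (S.erase v) h (by
            intro u hu
            have h1 := hS u (Finset.mem_of_mem_erase hu)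
            have h2 : h u ≠ N := fun h3 => Finset.ne_of_mem_erase hu
              (hinj (Finset.mem_of_mem_erase hu) hv (h3.trans hvN.symm))
            simp only [h2, if_false] at h1
            exact ⟨by omega, h1.2⟩)
          (hinj.mono (by simp)) (hSU.1.mono_left (Finset.erase_subset _ _))
        refine ⟨Z ++ c ++ (x ++ [v]), ?_, ?_, ?_, ?_⟩
        · have := Tight.comp hZT hTv (by omega)
          simpa using this
        · have e : Z ++ c ++ (x ++ [v]) ++ y = (Z ++ c) ++ (x ++ v :: y) := by simp
          rw [e, List.nodup_append]
          refine ⟨hZn, ?_, ?_⟩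
          · rw [List.nodup_middle]
            exact List.nodup_cons.2 ⟨hvxy, hn⟩
          · intro a ha b hb hab
            subst hab
            have ha' : a ∈ U ∪ S.erase v := by rw [← hZU]; simpa using ha
            have hb' : a = v ∨ a ∈ x ++ y := by
              simp at hb ⊢
              tauto
            simp only [Finset.mem_union, Finset.mem_erase] at ha'
            rcases hb' with rfl | hb'
            · rcases ha' with ha' | ha'
              · exact Finset.disjoint_left.1 hSU.1 hv ha'
              · exact ha'.1 rfl
            · rcases ha' with ha' | ha'
              · exact hxyU a hb' ha'
              · exact Finset.disjoint_left.1 hSU.2 ha'.2 (List.mem_toFinset.2 hb')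
        · have e : Z ++ c ++ (x ++ [v]) ++ y = (Z ++ c) ++ (x ++ v :: y) := by simp
          rw [e, List.toFinset_append, hZU]
          ext a
          by_cases hav : a = v
          · subst hav; simp [hv]
          · simp [hav]; tauto
        · exact hZb.trans ⟨x ++ [v] ++ y, by simp⟩
      · push Not at hex
        obtain ⟨Z, hZT, hZn, hZU, hZb⟩ := habs S h (by
            intro u hu
            have h1 := hS u hu
            simp only [hex u hu, if_false] at h1
            have := hex u hu
            exact ⟨by omega, h1.2⟩) hinj hSU.1
        refine ⟨Z ++ c ++ x, ?_, ?_, ?_, ?_⟩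
        · have := Tight.comp hZT hT (by omega)
          simpa using this
        · have e : Z ++ c ++ x ++ y = (Z ++ c) ++ (x ++ y) := by simp
          rw [e, List.nodup_append]
          refine ⟨hZn, hn, ?_⟩
          intro a ha b hb hab
          subst hab
          have ha' : a ∈ U ∪ S := by rw [← hZU]; simpa using ha
          rcases Finset.mem_union.1 ha' with ha' | ha'
          · exact hxyU a hb ha'
          · exact Finset.disjoint_left.1 hSU.2 ha' (List.mem_toFinset.2 hb)
        · have e : Z ++ c ++ x ++ y = (Z ++ c) ++ (x ++ y) := by simp
          rw [e, List.toFinset_append, hZU]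
          ext a
          simp; tauto
        · exact hZb.trans ⟨x ++ y, by simp⟩

/-- Hall-type selection. -/
lemma choose_units {V : Type*} [DecidableEq V] (S : Finset V) (N : ℕ) (G : ℕ → Finset V)
    (hS : ∀ v ∈ S, S.card ≤ ((range N).filter (fun i => v ∈ G i)).card) :
    ∃ h : V → ℕ, (∀ v ∈ S, h v < N ∧ v ∈ G (h v)) ∧ Set.InjOn h S := by
  classical
  obtain ⟨f, hf, hf2⟩ := (Finset.all_card_le_biUnion_card_iff_exists_injective
    (fun v : {v // v ∈ S} => (range N).filter (fun i => v.1 ∈ G i))).1 (by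
      intro s
      rcases s.eq_empty_or_nonempty with rfl | ⟨v, hv⟩
      · simp
      · calc s.card ≤ Fintype.card {v // v ∈ S} := Finset.card_le_univ s
          _ = S.card := by simp
          _ ≤ _ := hS v.1 v.2
          _ ≤ _ := Finset.card_le_card (Finset.subset_biUnion_of_mem
            (fun v : {v // v ∈ S} => (range N).filter (fun i => v.1 ∈ G i)) hv))
  refine ⟨fun v => if hv : v ∈ S then f ⟨v, hv⟩ else 0, ?_, ?_⟩
  · intro v hv
    have := hf2 ⟨v, hv⟩
    simp only [hv, dif_pos]
    simpa using this
  · intro a ha b hb hab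
    have ha' : a ∈ S := ha
    have hb' : b ∈ S := hb
    simp only [ha', hb', dif_pos] at hab
    exact congrArg Subtype.val (hf hab)

/-- A tight path of the right length is an `ℓ`-path. -/
lemma isLPath_of_tight {V : Type*} [DecidableEq V] (k ℓ : ℕ) (hℓ : ℓ < k)
    (E : Finset (Finset V)) (vs : List V) (hn : vs.Nodup) (hT : Tight k (· ∈ E) vs)
    (hm : ∃ m, 1 ≤ m ∧ vs.length = m * (k - ℓ) + ℓ) : IsLPathIn k ℓ E vs := by
  refine ⟨hn, hm, ?_⟩
  obtain ⟨m, hm1, hm⟩ := hm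
  intro e he
  simp only [pathEdges, Finset.mem_image, Finset.mem_range] at he
  obtain ⟨i, hi, rfl⟩ := he
  rw [hm, Nat.add_sub_cancel, Nat.mul_div_cancel _ (by omega)] at hi
  have h1 : (i + 1) * (k - ℓ) ≤ m * (k - ℓ) := Nat.mul_le_mul_right _ hi
  rw [Nat.add_mul, one_mul] at h1
  refine hT (vs.take (i * (k - ℓ))) _ ((vs.drop (i * (k - ℓ))).drop k) ?_ ?_
  · rw [List.append_assoc, List.take_append_drop, List.take_append_drop]
  · simp; omega

/-- Lemma 2.2, absorbing lemma: under
`δ⁺(H) ≥ (1 - 1/⌈k/(k-ℓ)⌉)n + αn` and no isolated vertices, there is a small set `A` and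
ends `x ≠ y` such that every small set `S` disjoint from `A` with `(k-ℓ) ∣ |S|` can be
absorbed: there is an `ℓ`-path in `H` with vertex set `A ∪ S` and ends `x`, `y`. -/
theorem statement11 (k ℓ : ℕ) (hk : 3 ≤ k) (hℓ1 : 1 ≤ ℓ) (hℓ2 : ℓ ≤ k - 1) :
    ∃ α₀ : ℝ, 0 < α₀ ∧ ∀ α : ℝ, 0 < α → α < α₀ →
      ∃ β₀ : ℝ, 0 < β₀ ∧ ∀ β : ℝ, 0 < β → β < β₀ →
        ∃ n₀ : ℕ, ∀ n : ℕ, n₀ ≤ n →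
          ∀ E : Finset (Finset (Fin n)), (∀ e ∈ E, e.card = k) →
            (1 - 1 / (((k + (k - ℓ) - 1) / (k - ℓ) : ℕ) : ℝ)) * n + α * n ≤ (posCodeg k E : ℝ) →
            (∀ v : Fin n, 1 ≤ degH E {v}) →
            ∃ (A : Finset (Fin n)) (xs ys : List (Fin n)),
              (A.card : ℝ) ≤ β * n ∧
              xs.length = ℓ ∧ ys.length = ℓ ∧ xs.Nodup ∧ ys.Nodup ∧ xs ≠ ys ∧
              ∀ S : Finset (Fin n), Disjoint S A → (S.card : ℝ) ≤ β ^ 2 * n →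
                (k - ℓ) ∣ S.card →
                ∃ vs : List (Fin n), IsLPathIn k ℓ E vs ∧ vs.toFinset = A ∪ S ∧
                  vs.take ℓ = xs ∧ vs.drop (vs.length - ℓ) = ys := by
  refine ⟨1, one_pos, fun α hα hα1 => ?_⟩
  set p : ℝ := α ^ (2 * k - 1) with hp_def
  have hp : 0 < p := by positivity
  have hp1 : p ≤ 1 := pow_le_one₀ hα.le hα1.le
  have hkR : (3 : ℝ) ≤ k := by exact_mod_cast hk
  set g := k - ℓ with hg
  have hg1 : 1 ≤ g := by omega
  have hgR : (1 : ℝ) ≤ g := by exact_mod_cast hg1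
  refine ⟨min (α / 2) (p / (16 * k)), by positivity, fun β hβ hβ0 => ?_⟩
  have hβα : β < α / 2 := hβ0.trans_le (min_le_left _ _)
  have hβp : β < p / (16 * k) := hβ0.trans_le (min_le_right _ _)
  set C : ℝ := p * β / (16 * k) with hC
  have hCpos : 0 < C := by positivity
  have ev : ∀ᶠ n : ℕ in Filter.atTop, Real.log n + p * g / 2 < C * n ∧
      (k : ℝ) ≤ β * n / 2 ∧ 2 * (k : ℝ) + 1 ≤ α * n / 2 ∧ 1 ≤ n := by
    have hT : Filter.Tendsto (fun n : ℕ => (n : ℝ)) Filter.atTop Filter.atTop :=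
      tendsto_natCast_atTop_atTop
    have h1 : ∀ᶠ n : ℕ in Filter.atTop, ‖Real.log n‖ ≤ C / 4 * ‖(n : ℝ)‖ :=
      hT.eventually (Real.isLittleO_log_id_atTop.def (show 0 < C / 4 by positivity))
    have h2 := hT.eventually_ge_atTop (4 * (p * g / 2) / C)
    have h3 := hT.eventually_ge_atTop (2 * k / β)
    have h4 := hT.eventually_ge_atTop (2 * (2 * k + 1) / α)
    filter_upwards [h1, h2, h3, h4, Filter.eventually_ge_atTop 1] with n h1 h2 h3 h4 h5
    rw [div_le_iff₀ (by positivity)] at h2 h3 h4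
    have hn : (1 : ℝ) ≤ n := by exact_mod_cast h5
    have h6 : Real.log n ≤ C / 4 * n := by
      have := (le_abs_self _).trans h1
      simpa using this
    have h7 : 0 < C * n := by positivity
    refine ⟨by linarith, by linarith, by linarith, h5⟩
  obtain ⟨n₀, hn₀⟩ := Filter.eventually_atTop.1 ev
  refine ⟨n₀, fun n hn E hE hdeg hiso => ?_⟩
  obtain ⟨hlog, hkn, hαn, hn1⟩ := hn₀ n hn
  have hnR : (1 : ℝ) ≤ n := by exact_mod_cast hn1
  set T := (k + g - 1) / g with hTdef
  have hT2 : 2 ≤ T := by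
    rw [hTdef, Nat.le_div_iff_mul_le (by omega)]
    omega
  have hTR : (2 : ℝ) ≤ T := by exact_mod_cast hT2
  have hhalf : (1 / 2 + α) * n ≤ posCodeg k E := by
    have h1 : 1 / (T : ℝ) ≤ 1 / 2 := one_div_le_one_div_of_le (by norm_num) hTR
    have h2 : (1 / 2 : ℝ) * n ≤ (1 - 1 / (T : ℝ)) * n :=
      mul_le_mul_of_nonneg_right (by linarith) (by linarith)
    linarith
  -- number of units
  set M := ⌊β * n / (4 * k * g)⌋₊ with hM
  set N := g * M with hN
  have hMle : (M : ℝ) ≤ β * n / (4 * k * g) := Nat.floor_le (by positivity)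
  have hMge : β * n / (4 * k * g) < M + 1 := Nat.lt_floor_add_one _
  rw [le_div_iff₀ (by positivity)] at hMle
  rw [div_lt_iff₀ (by positivity)] at hMge
  have hNR : (N : ℝ) = g * M := by simp [hN]
  have hN1 : 4 * k * (N : ℝ) ≤ β * n := by rw [hNR]; linarith
  have hN2 : β * n < 4 * k * (N + g) := by rw [hNR]; linarith
  have hN0 : (0 : ℝ) ≤ N := Nat.cast_nonneg _
  have hsize : (k : ℝ) + (2 * k - 1 : ℕ) * N ≤ β * n := by
    rw [Nat.cast_sub (by omega)]
    push_cast
    linarith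
  obtain ⟨e, he⟩ := Finset.card_pos.1
    (show 0 < (E.filter (fun e => {(⟨0, hn1⟩ : Fin n)} ⊆ e)).card from hiso ⟨0, hn1⟩)
  have heE := (Finset.mem_filter.1 he).1
  have hbl : e.toList.length = k := by simp [hE e heE]
  have hqle : ((⌈α * n⌉₊ : ℕ) : ℝ) < α * n + 1 := Nat.ceil_lt_add_one (by positivity)
  have hqge : α * n ≤ ((⌈α * n⌉₊ : ℕ) : ℝ) := Nat.le_ceil _
  have hβn : β * n ≤ α * n / 2 := by
    have := mul_le_mul_of_nonneg_right hβα.le (show (0 : ℝ) ≤ n by linarith)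
    linarith
  obtain ⟨c, U, G, hc, hcE, hUc, hpot, habs⟩ := build k hk E hE hiso e.toList hbl
    e.nodup_toList (by simpa using heE) ⌈α * n⌉₊ p hp hp1
    (by
      rw [hp_def, ← mul_pow, Fintype.card_fin]
      exact pow_le_pow_left₀ (by positivity) hqge _) N
    (by
      rw [Fintype.card_fin]
      have : ((⌈α * n⌉₊ : ℕ) : ℝ) + (k + (2 * k - 1 : ℕ) * N + 1 + (2 * k - 1 : ℕ)) + n
          ≤ 2 * posCodeg k E := by
        have h2 : ((2 * k - 1 : ℕ) : ℝ) = 2 * k - 1 := by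
          rw [Nat.cast_sub (by omega)]; push_cast; ring
        rw [h2] at hsize ⊢
        linarith
      exact_mod_cast this)
    (by
      rw [Fintype.card_fin]
      have : (k : ℝ) + (2 * k - 1 : ℕ) * N < n := by
        have := mul_lt_mul_of_pos_right hα1 (show (0 : ℝ) < n by linarith)
        linarith
      exact_mod_cast this) N le_rfl
  rw [Fintype.card_fin] at hpot
  have hsmall : n * (1 - p / 2) ^ N < Real.exp (- (β ^ 2 * n)) := by
    have h1 : (1 - p / 2) ^ N ≤ Real.exp (-(p / 2) * N) := by
      have := Real.add_one_le_exp (-(p / 2))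
      calc (1 - p / 2) ^ N ≤ (Real.exp (-(p / 2))) ^ N :=
            pow_le_pow_left₀ (by linarith) (by linarith) _
        _ = _ := by rw [← Real.exp_nat_mul]; ring_nf
    calc n * (1 - p / 2) ^ N ≤ n * Real.exp (-(p / 2) * N) := by gcongr
      _ = Real.exp (Real.log n + -(p / 2) * N) := by
        rw [Real.exp_add, Real.exp_log (by linarith)]
      _ < _ := by
        apply Real.exp_lt_exp.2
        have h2 : β ^ 2 * n ≤ C * n := by
          apply mul_le_mul_of_nonneg_right _ (by linarith)
          rw [hC, sq, mul_comm p, mul_div_assoc]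
          exact mul_le_mul_of_nonneg_left hβp.le hβ.le
        have h3 : C * n * 2 ≤ p / 2 * (N + g) := by
          have : C * n * 2 = p / (8 * k) * (β * n) := by rw [hC]; field_simp; ring
          rw [this]
          calc p / (8 * k) * (β * n) ≤ p / (8 * k) * (4 * k * (N + g)) := by gcongr
            _ = _ := by field_simp; ring
        linarith
  have hhits : ∀ S : Finset (Fin n), Disjoint S U → (S.card : ℝ) ≤ β ^ 2 * n →
      ∀ v ∈ S, S.card ≤ ((range N).filter (fun i => v ∈ G i)).card := by
    intro S hSU hSc v hv
    have hvU : v ∈ Uᶜ := by simpa using Finset.disjoint_left.1 hSU hv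
    have h1 := Finset.single_le_sum (f := fun v => (1 / 2 : ℝ) ^
      ((range N).filter (fun i => v ∈ G i)).card) (fun v _ => by positivity) hvU
    by_contra hlt
    push Not at hlt
    have h2 : (1 / 2 : ℝ) ^ S.card ≤ (1 / 2 : ℝ) ^ ((range N).filter (fun i => v ∈ G i)).card :=
      pow_le_pow_of_le_one (by norm_num) (by norm_num) hlt.le
    have h3 : Real.exp (- (β ^ 2 * n)) ≤ (1 / 2 : ℝ) ^ S.card := by
      have h4 : Real.exp (-1) ≤ 1 / 2 := by
        rw [Real.exp_neg, one_div]
        apply inv_anti₀ (by norm_num)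
        have := Real.add_one_le_exp (1 : ℝ)
        linarith
      calc Real.exp (- (β ^ 2 * n)) ≤ Real.exp (S.card * (-1)) := by
            apply Real.exp_le_exp.2; linarith
        _ = Real.exp (-1) ^ S.card := Real.exp_nat_mul _ _
        _ ≤ _ := pow_le_pow_left₀ (Real.exp_pos _).le h4 _
    linarith
  have final : ∀ S : Finset (Fin n), Disjoint S U → (S.card : ℝ) ≤ β ^ 2 * n → g ∣ S.card →
      ∃ vs : List (Fin n), IsLPathIn k ℓ E vs ∧ vs.toFinset = U ∪ S ∧
        vs.take ℓ = e.toList.take ℓ ∧ vs.drop (vs.length - ℓ) = c.drop (k - ℓ) := by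
    intro S hSU hSc hdvd
    obtain ⟨h, hh, hinj⟩ := choose_units S N G (hhits S hSU hSc)
    obtain ⟨Z, hZT, hZn, hZU, hZb⟩ := habs S h hh hinj hSU
    have hlen : (Z ++ c).length = k + (2 * k - 1) * N + S.card := by
      rw [← List.toFinset_card_of_nodup hZn, hZU, Finset.card_union_of_disjoint hSU.symm, hUc]
    refine ⟨Z ++ c, ?_, hZU, ?_, ?_⟩
    · apply isLPath_of_tight k ℓ (by omega) E _ hZn hZT
      obtain ⟨r, hr⟩ := hdvd
      refine ⟨1 + (2 * k - 1) * M + r, by omega, ?_⟩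
      rw [hlen, hr, hN, ← hg]
      have : k = g + ℓ := by omega
      have e2 : (1 + (2 * k - 1) * M + r) * g = g + (2 * k - 1) * (g * M) + g * r := by ring
      rw [e2]
      omega
    · obtain ⟨t, ht⟩ := hZb
      rw [← ht, List.take_append_of_le_length (by omega)]
    · have : (Z ++ c).length - ℓ = Z.length + (k - ℓ) := by simp; omega
      rw [this, List.drop_append]
      simp
  refine ⟨U, e.toList.take ℓ, c.drop (k - ℓ), ?_, by simp [hE e heE]; omega, by simp; omega, ?_,
    ?_, ?_, final⟩
  · rw [hUc]
    exact_mod_cast hsize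
  · exact (List.take_sublist _ _).nodup e.nodup_toList
  · obtain ⟨vs, hvs, -, -, h4⟩ := final ∅ (by simp) (by simp; positivity) (by simp)
    rw [← h4]
    exact (List.drop_sublist _ _).nodup hvs.1
  · obtain ⟨vs, hvs, -, h3, h4⟩ := final ∅ (by simp) (by simp; positivity) (by simp)
    rw [← h3, ← h4]
    obtain ⟨hnd, ⟨m, hm1, hm⟩, -⟩ := hvs
    have hmg : 1 ≤ m * (k - ℓ) := Nat.mul_pos hm1 (by omega)
    intro heq
    have h5 : (vs.take ℓ)[0]? = (vs.drop (vs.length - ℓ))[0]? := by rw [heq]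
    rw [List.getElem?_take_of_lt (by omega), List.getElem?_drop,
      List.getElem?_eq_getElem (by omega), List.getElem?_eq_getElem (by omega)] at h5
    have h6 := (hnd.getElem_inj_iff).1 (Option.some.inj h5)
    omega
end

section
/- Fix integers k ≥ 3 and 1 ≤ ℓ ≤ k-1 and reals β, α > 0 (sufficiently small in terms of k). Then there exist an integer M and an integer n₀ such that the following holds. If H is a k-graph on n ≥ n₀ vertices with δ⁺(H) ≥ (1 - 1/(⌊k/(k-ℓ)⌋(k-ℓ)))·n + αn and H has no isolated vertices, then there exists a collection 𝒫 of at most M pairwise vertex-disjoint ℓ-paths in H such that the union of the vertex sets of the paths in 𝒫 has size at least (1-β)n. -/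
open Finset

theorem codeg_aux {V : Type*} [Fintype V] [DecidableEq V] {k : ℕ} (E : Finset (Finset V))
    (hE : ∀ e ∈ E, e.card = k) (f : Fin k → V) (hf : univ.image f ∈ E) (i : Fin k) :
    posCodeg k E ≤
      (univ.filter (fun v => univ.image (Function.update f i v) ∈ E)).card := by
  have hinj : Function.Injective f := by
    have h := hE _ hf
    have h2 : (univ.image f).card = (univ : Finset (Fin k)).card := by simpa using h
    exact fun a b hab => Finset.card_image_iff.1 h2 (by simp) (by simp) hab
  set S := (univ.erase i).image f with hS
  have hScard : S.card = k - 1 := by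
    rw [hS, Finset.card_image_of_injective _ hinj, Finset.card_erase_of_mem (by simp)]
    simp
  have hSsub : S ⊆ univ.image f := Finset.image_subset_image (Finset.erase_subset _ _)
  have hdeg : 1 ≤ degH E S := by
    unfold degH
    exact Finset.card_pos.2 ⟨_, Finset.mem_filter.2 ⟨hf, hSsub⟩⟩
  have h1 : posCodeg k E ≤ degH E S := Nat.sInf_le ⟨S, hScard, hdeg, rfl⟩
  refine h1.trans ?_
  unfold degH
  have hk : 1 ≤ k := by have := i.2; omega
  have himg : ∀ v, univ.image (Function.update f i v) = insert v S := by
    intro v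
    ext w
    simp only [mem_image, mem_univ, true_and, mem_insert, hS, mem_erase]
    constructor
    · rintro ⟨a, ha⟩
      by_cases hai : a = i
      · subst hai; left; simpa using ha.symm
      · right; exact ⟨a, by simpa using hai, by simpa [Function.update_of_ne hai] using ha⟩
    · rintro (rfl | ⟨a, ha, rfl⟩)
      · exact ⟨i, by simp⟩
      · exact ⟨a, by rw [Function.update_of_ne]; simpa using ha⟩
  have hsub : E.filter (fun e => S ⊆ e) ⊆
      (univ.filter (fun v => univ.image (Function.update f i v) ∈ E)).image
        (fun v => univ.image (Function.update f i v)) := by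
    intro e he
    obtain ⟨heE, hSe⟩ := Finset.mem_filter.1 he
    have hc : (e \ S).card = 1 := by
      rw [Finset.card_sdiff_of_subset hSe, hE e heE, hScard]; omega
    obtain ⟨v, hv⟩ := Finset.card_eq_one.1 hc
    have hev : insert v S = e := by
      rw [Finset.insert_eq, ← hv, Finset.sdiff_union_of_subset hSe]
    refine Finset.mem_image.2 ⟨v, ?_, ?_⟩
    · simp [himg, hev, heE]
    · simp [himg, hev]
  exact (Finset.card_le_card hsub).trans Finset.card_image_le

theorem count_aux {V ι : Type*} [Fintype V] [DecidableEq V] [Fintype ι] [DecidableEq ι]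
    (F : Finset (ι → V)) (X : Finset V) (D : ℕ)
    (hF : ∀ f ∈ F, ∀ i, D ≤ (X.filter (fun v => Function.update f i v ∈ F)).card)
    (J : Finset ι) (f : ι → V) (hf : f ∈ F) :
    D ^ J.card ≤ (F.filter (fun g => (∀ i, i ∉ J → g i = f i) ∧ ∀ i ∈ J, g i ∈ X)).card := by
  induction J using Finset.induction_on with
  | empty =>
    simp only [card_empty, pow_zero]
    exact Finset.card_pos.2 ⟨f, by simp [hf]⟩
  | insert j J hj ih =>
    rw [Finset.card_insert_of_notMem hj, pow_succ]
    set G := F.filter (fun g => (∀ i, i ∉ J → g i = f i) ∧ ∀ i ∈ J, g i ∈ X) with hG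
    have h1 : D ^ J.card * D ≤ (G.sigma (fun g => X.filter (fun v => Function.update g j v ∈ F))).card := by
      rw [Finset.card_sigma]
      calc D ^ J.card * D ≤ G.card * D := Nat.mul_le_mul_right _ ih
        _ = ∑ g ∈ G, D := by simp
        _ ≤ _ := Finset.sum_le_sum (fun g hg => hF g (Finset.mem_filter.1 hg).1 j)
    refine h1.trans ?_
    refine Finset.card_le_card_of_injOn (fun p => Function.update p.1 j p.2) ?_ ?_
    · rintro ⟨g, v⟩ hp
      simp only [coe_sigma, Set.mem_sigma_iff, mem_coe, mem_filter, hG] at hp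
      obtain ⟨⟨hg, hg1, hg2⟩, hv, hu⟩ := hp
      simp only [coe_filter, Set.mem_setOf_eq]
      refine ⟨hu, ?_, ?_⟩
      · intro i hi
        simp only [mem_insert, not_or] at hi
        rw [Function.update_of_ne hi.1]; exact hg1 i hi.2
      · intro i hi
        by_cases hij : i = j
        · subst hij; simpa using hv
        · rw [Function.update_of_ne hij]
          exact hg2 i ((Finset.mem_insert.1 hi).resolve_left hij)
    · rintro ⟨g, v⟩ hp ⟨g', v'⟩ hp' heq
      simp only [coe_sigma, Set.mem_sigma_iff, mem_coe, mem_filter, hG] at hp hp'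
      simp only at heq
      have hv : v = v' := by simpa using congrFun heq j
      have hg : g = g' := by
        ext i
        by_cases hij : i = j
        · subst hij; rw [hp.1.2.1 i hj, hp'.1.2.1 i hj]
        · simpa [Function.update_of_ne hij] using congrFun heq i
      subst hv; subst hg; rfl

/-- lowest sets -/
theorem low_aux {V : Type*} [DecidableEq V] (x : V → ℝ) (U : Finset V) (j : ℕ) (hj : j ≤ U.card) :
    ∃ X ⊆ U, X.card = j ∧ ∀ u ∈ X, ∀ w ∈ U, w ∉ X → x u ≤ x w := by
  induction j with
  | zero => exact ⟨∅, by simp, by simp, by simp⟩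
  | succ j ih =>
    obtain ⟨X, hXU, hc, hX⟩ := ih (by omega)
    have hne : (U \ X).Nonempty := by
      rw [← Finset.card_pos, Finset.card_sdiff_of_subset hXU]; omega
    obtain ⟨a, ha, hmin⟩ := Finset.exists_min_image (U \ X) x hne
    rw [Finset.mem_sdiff] at ha
    refine ⟨insert a X, ?_, ?_, ?_⟩
    · exact Finset.insert_subset ha.1 hXU
    · rw [Finset.card_insert_of_notMem ha.2, hc]
    · intro u hu w hw hwX
      simp only [mem_insert, not_or] at hwX hu
      rcases hu with rfl | hu
      · exact hmin w (Finset.mem_sdiff.2 ⟨hw, hwX.2⟩)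
      · exact hX u hu w hw hwX.2

theorem avg_aux {V : Type*} [DecidableEq V] (g : V → ℝ) (A : Finset V) (m : ℕ) (hm : m ≤ A.card) :
    ∃ C ⊆ A, C.card = m ∧ (∑ v ∈ A, g v) * m ≤ (∑ v ∈ C, g v) * A.card := by
  obtain ⟨C, hCA, hc, hC⟩ := low_aux (fun v => - g v) A m hm
  refine ⟨C, hCA, hc, ?_⟩
  have h1 : ∑ w ∈ A \ C, ∑ u ∈ C, g w ≤ ∑ w ∈ A \ C, ∑ u ∈ C, g u := by
    refine Finset.sum_le_sum (fun w hw => Finset.sum_le_sum (fun u hu => ?_))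
    rw [Finset.mem_sdiff] at hw
    have := hC u hu w hw.1 hw.2
    linarith
  simp only [sum_const, nsmul_eq_mul, ← Finset.mul_sum] at h1
  have h2 : (∑ v ∈ A, g v) = ∑ v ∈ A \ C, g v + ∑ v ∈ C, g v :=
    (Finset.sum_sdiff hCA).symm
  have h3 : (A.card : ℝ) = (A \ C).card + m := by
    rw [← hc, ← Nat.cast_add, Finset.card_sdiff_add_card_eq_card hCA]
  rw [hc] at h1
  rw [h2, h3]; nlinarith

def cnt {V ι : Type*} [Fintype ι] [DecidableEq V]
    (F : Finset (ι → V)) (A : ι → Finset V) : ℕ := (F.filter (fun f => ∀ i, f i ∈ A i)).card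

theorem cnt_mono {V ι : Type*} [Fintype ι] [DecidableEq V]
    (F : Finset (ι → V)) {A B : ι → Finset V} (h : ∀ i, A i ⊆ B i) : cnt F A ≤ cnt F B := by
  unfold cnt
  refine Finset.card_le_card (fun f hf => ?_)
  rw [Finset.mem_filter] at hf ⊢
  exact ⟨hf.1, fun i => h i (hf.2 i)⟩

theorem cnt_update {V ι : Type*} [Fintype ι] [DecidableEq ι] [DecidableEq V]
    (F : Finset (ι → V)) (A : ι → Finset V) (j : ι) (C : Finset V) :
    cnt F (Function.update A j C) =
      ∑ v ∈ C, (F.filter (fun f => f j = v ∧ ∀ i, i ≠ j → f i ∈ A i)).card := by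
  unfold cnt
  rw [Finset.card_eq_sum_card_fiberwise (f := fun f => f j) (t := C)]
  · refine Finset.sum_congr rfl (fun v hv => ?_)
    congr 1
    ext f
    simp only [mem_filter]
    constructor
    · rintro ⟨⟨h1, h2⟩, h3⟩
      refine ⟨h1, h3, fun i hi => ?_⟩
      simpa [Function.update_of_ne hi] using h2 i
    · rintro ⟨h1, h2, h3⟩
      refine ⟨⟨h1, fun i => ?_⟩, h2⟩
      by_cases hi : i = j
      · subst hi; simpa [h2] using hv
      · simpa [Function.update_of_ne hi] using h3 i hi
  · intro f hf
    simp only [coe_filter] at hf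
    simpa using hf.2 j

theorem shrink_aux {V ι : Type*} [Fintype ι] [DecidableEq ι] [DecidableEq V]
    (F : Finset (ι → V)) (A : ι → Finset V) (m : ℕ) (hm : ∀ i, m ≤ (A i).card) (hm1 : 1 ≤ m)
    (ρ : ℝ) (hρ : ρ * ∏ i, ((A i).card : ℝ) ≤ cnt F A) :
    ∃ A' : ι → Finset V, (∀ i, A' i ⊆ A i) ∧ (∀ i, (A' i).card = m) ∧
      ρ * (m : ℝ) ^ (Fintype.card ι) ≤ cnt F A' := by
  have key : ∀ J : Finset ι, ∃ A' : ι → Finset V, (∀ i, A' i ⊆ A i) ∧ (∀ i ∈ J, (A' i).card = m) ∧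
      (∀ i, i ∉ J → A' i = A i) ∧ ρ * ∏ i, ((A' i).card : ℝ) ≤ cnt F A' := by
    intro J
    induction J using Finset.induction_on with
    | empty => exact ⟨A, by simp, by simp, by simp, hρ⟩
    | insert j J hj ih =>
      obtain ⟨A', h1, h2, h3, h4⟩ := ih
      obtain ⟨C, hCA, hc, hC⟩ := avg_aux
        (fun v : V => ((F.filter (fun f : ι → V => f j = v ∧ ∀ i, i ≠ j → f i ∈ A' i)).card : ℝ)) (A' j) m
        (by rw [h3 j hj]; exact hm j)
      refine ⟨Function.update A' j C, ?_, ?_, ?_, ?_⟩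
      · intro i
        by_cases hi : i = j
        · subst hi; simpa using hCA.trans (h1 i)
        · simpa [Function.update_of_ne hi] using h1 i
      · intro i hi
        by_cases hij : i = j
        · subst hij; simpa using hc
        · simpa [Function.update_of_ne hij] using h2 i ((Finset.mem_insert.1 hi).resolve_left hij)
      · intro i hi
        simp only [mem_insert, not_or] at hi
        rw [Function.update_of_ne hi.1]; exact h3 i hi.2
      · rw [← Nat.cast_sum, ← Nat.cast_sum, ← cnt_update, ← cnt_update,
          Function.update_eq_self] at hC
        have hpos : (0 : ℝ) < (A' j).card := by
          rw [h3 j hj]; exact_mod_cast lt_of_lt_of_le hm1 (hm j)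
        rw [← Finset.mul_prod_erase univ _ (Finset.mem_univ j)] at h4 ⊢
        have hp : ∏ i ∈ univ.erase j, ((Function.update A' j C i).card : ℝ)
            = ∏ i ∈ univ.erase j, ((A' i).card : ℝ) := by
          refine Finset.prod_congr rfl (fun i hi => ?_)
          rw [Function.update_of_ne (Finset.ne_of_mem_erase hi)]
        rw [hp, Function.update_self, hc]
        set P := ∏ i ∈ univ.erase j, ((A' i).card : ℝ)
        have : (ρ * (m * P)) * (A' j).card ≤ cnt F (Function.update A' j C) * (A' j).card := by
          refine le_trans ?_ hC
          have := mul_le_mul_of_nonneg_right h4 (Nat.cast_nonneg (α := ℝ) m)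
          linarith
        exact le_of_mul_le_mul_right this hpos
  obtain ⟨A', h1, h2, _, h4⟩ := key univ
  refine ⟨A', h1, fun i => h2 i (by simp), ?_⟩
  simpa [h2] using h4

/-- density increment: one step -/
theorem incr_aux {V ι : Type*} [Fintype ι] [DecidableEq ι] [DecidableEq V]
    (F : Finset (ι → V)) (A B : ι → Finset V) (m m' : ℕ) (hA : ∀ i, (A i).card = m)
    (hBA : ∀ i, B i ⊆ A i) (hB : ∀ i, (B i).card = m') (hm' : 1 ≤ m') (h2 : 2 * m' ≤ m)
    (ε : ℝ) (hε : 0 < ε) (hεm : ε * m ≤ m')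
    (ρ : ℝ) (hρ0 : 0 < ρ) (hρ : ρ * (m : ℝ) ^ (Fintype.card ι) ≤ cnt F A)
    (hlow : (cnt F B : ℝ) < ρ / 2 * (m' : ℝ) ^ (Fintype.card ι)) :
    ∃ A' : ι → Finset V, (∀ i, A' i ⊆ A i) ∧ (∀ i, (A' i).card = m') ∧
      ρ * (1 + ε ^ (Fintype.card ι) / 2) * (m' : ℝ) ^ (Fintype.card ι) ≤ cnt F A' := by
  set K := Fintype.card ι with hK
  set ξ := ε ^ K / 2 with hξ
  have hξ0 : 0 < ξ := by positivity
  let box : Finset ι → ι → Finset V := fun J i => if i ∈ J then B i else A i \ B i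
  have hboxcard : ∀ J i, m' ≤ (box J i).card := by
    intro J i
    simp only [box]
    split_ifs
    · rw [hB]
    · rw [Finset.card_sdiff_of_subset (hBA i), hA, hB]; omega
  have hboxsub : ∀ J i, box J i ⊆ A i := by
    intro J i
    simp only [box]
    split_ifs
    · exact hBA i
    · exact Finset.sdiff_subset
  by_cases hex : ∃ J, ρ * (1 + ξ) * ∏ i, ((box J i).card : ℝ) ≤ cnt F (box J)
  · obtain ⟨J, hJ⟩ := hex
    obtain ⟨A', h1, h2, h3⟩ := shrink_aux F (box J) m' (hboxcard J) hm' _ hJ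
    exact ⟨A', fun i => (h1 i).trans (hboxsub J i), h2, h3⟩
  · exfalso
    push Not at hex
    have hsum : (cnt F A) = ∑ J : Finset ι, cnt F (box J) := by
      unfold cnt
      rw [Finset.card_eq_sum_card_fiberwise (f := fun f : ι → V => univ.filter (fun i => f i ∈ B i))
        (t := univ) (by intro f _; simp)]
      refine Finset.sum_congr rfl (fun J _ => ?_)
      congr 1
      ext f
      simp only [mem_filter, box]
      constructor
      · rintro ⟨⟨h1, h2⟩, h3⟩
        refine ⟨h1, fun i => ?_⟩
        subst h3
        by_cases hi : f i ∈ B i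
        · simp [hi]
        · simp [hi, h2 i]
      · rintro ⟨h1, h2⟩
        refine ⟨⟨h1, fun i => hboxsub J i (h2 i)⟩, ?_⟩
        ext i
        have := h2 i
        by_cases hi : i ∈ J
        · simpa [hi] using this
        · simp only [hi, if_false, mem_sdiff] at this
          simp [hi, this.2]
    have hvol : ∑ J : Finset ι, ∏ i, ((box J i).card : ℝ) = (m : ℝ) ^ K := by
      have := Finset.prod_add (fun i : ι => ((B i).card : ℝ)) (fun i => ((A i \ B i).card : ℝ)) univ
      have h5 : ∀ i, ((B i).card : ℝ) + ((A i \ B i).card : ℝ) = m := by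
        intro i
        rw [← Nat.cast_add, add_comm, Finset.card_sdiff_add_card_eq_card (hBA i), hA]
      simp only [h5, prod_const, Finset.powerset_univ] at this
      rw [hK, ← Finset.card_univ, this]
      refine Finset.sum_congr rfl (fun J _ => ?_)
      rw [← Finset.prod_mul_prod_compl J]
      congr 1
      · exact Finset.prod_congr rfl (fun i hi => by simp [box, hi])
      · rw [← Finset.compl_eq_univ_sdiff]
        exact Finset.prod_congr rfl (fun i hi => by simp [box, Finset.mem_compl.1 hi])
    have hbu : box univ = B := by ext1 i; simp [box]
    have hs1 : (cnt F A : ℝ) ≤ cnt F B + ∑ J ∈ univ.erase (univ : Finset ι),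
        ρ * (1 + ξ) * ∏ i, ((box J i).card : ℝ) := by
      rw [hsum, Nat.cast_sum, ← Finset.add_sum_erase univ _ (Finset.mem_univ univ), hbu]
      gcongr with J hJ
      exact (hex J).le
    rw [← Finset.add_sum_erase univ _ (Finset.mem_univ univ), hbu] at hvol
    simp only [hB, prod_const, Finset.card_univ, ← hK] at hvol
    rw [← Finset.mul_sum] at hs1
    set Sg := ∑ J ∈ univ.erase (univ : Finset ι), ∏ i, ((box J i).card : ℝ)
    have hlow2 : ε ^ K * (m : ℝ) ^ K ≤ (m' : ℝ) ^ K := by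
      rw [← mul_pow]; gcongr
    have hmpos : (0 : ℝ) < (m : ℝ) ^ K := by
      have : (0 : ℝ) < m := by exact_mod_cast (by omega : 0 < m)
      positivity
    have hS : Sg = (m : ℝ) ^ K - (m' : ℝ) ^ K := by linarith
    rw [hS] at hs1
    have h7 : ρ * (m : ℝ) ^ K < ρ * ((1 / 2) * (m' : ℝ) ^ K +
        (1 + ξ) * ((m : ℝ) ^ K - (m' : ℝ) ^ K)) := by
      linarith
    have h8 := lt_of_mul_lt_mul_left h7 hρ0.le
    have h9 : ξ * (m : ℝ) ^ K ≤ (m' : ℝ) ^ K / 2 := by rw [hξ]; linarith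
    have h10 : 0 ≤ ξ * (m' : ℝ) ^ K := by positivity
    nlinarith

/-- regular tuples exist -/
theorem regular_aux {V ι : Type*} [Fintype ι] [DecidableEq ι] [DecidableEq V] [Fintype V]
    (F : Finset (ι → V)) (ε : ℝ) (hε : 0 < ε) (hε4 : ε ≤ 1 / 4) (ρ : ℝ) (hρ0 : 0 < ρ) (N : ℕ)
    (hN : 1 < ρ * (1 + ε ^ (Fintype.card ι) / 2) ^ N)
    (A : ι → Finset V) (m₀ : ℕ) (hA : ∀ i, (A i).card = m₀)
    (hm₀ : 4 ≤ ε ^ N * m₀)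
    (hρ : ρ * (m₀ : ℝ) ^ (Fintype.card ι) ≤ cnt F A) :
    ∃ (A' : ι → Finset V) (m : ℕ), (∀ i, A' i ⊆ A i) ∧ (∀ i, (A' i).card = m) ∧
      ε ^ N * m₀ ≤ m ∧ ∀ B : ι → Finset V, (∀ i, B i ⊆ A' i) → (∀ i, ε * m ≤ (B i).card) →
        ρ / 2 * (ε * m) ^ (Fintype.card ι) ≤ cnt F B := by
  by_contra hcon
  have key : ∀ j, j ≤ N → ∃ (A' : ι → Finset V) (m : ℕ), (∀ i, A' i ⊆ A i) ∧
      (∀ i, (A' i).card = m) ∧ ε ^ j * m₀ ≤ m ∧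
      ρ * (1 + ε ^ (Fintype.card ι) / 2) ^ j * (m : ℝ) ^ (Fintype.card ι) ≤ cnt F A' := by
    intro j
    induction j with
    | zero => intro _; exact ⟨A, m₀, by simp, hA, by simp, by simpa using hρ⟩
    | succ j ih =>
      intro hj
      obtain ⟨A', m, h1, h2, h3, h4⟩ := ih (by omega)
      have hεj : ε ^ N * m₀ ≤ m := le_trans (by
        gcongr ?_ * _
        exact pow_le_pow_of_le_one hε.le (by linarith) (by omega)) h3
      have hpow : 1 ≤ (1 + ε ^ (Fintype.card ι) / 2) ^ j := one_le_pow₀ (by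
        have : 0 < ε ^ (Fintype.card ι) := by positivity
        linarith)
      by_contra hcon2
      apply hcon
      refine ⟨A', m, h1, h2, hεj, ?_⟩
      intro B hBA hBm
      by_contra hlow
      push Not at hlow
      apply hcon2
      have hmm : ∀ i, ⌈ε * m⌉₊ ≤ (B i).card := fun i => Nat.ceil_le.2 (hBm i)
      choose B' hB'B hB' using fun i => Finset.exists_subset_card_eq (hmm i)
      have hm4 : (4 : ℝ) ≤ m := hm₀.trans hεj
      have hc1 : 1 ≤ ⌈ε * m⌉₊ := Nat.ceil_pos.2 (by positivity)
      have hc2 : 2 * ⌈ε * (m : ℝ)⌉₊ ≤ m := by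
        have := Nat.ceil_lt_add_one (show 0 ≤ ε * (m : ℝ) by positivity)
        have h9 : (2 * ⌈ε * (m : ℝ)⌉₊ : ℝ) ≤ m := by nlinarith
        exact_mod_cast h9
      obtain ⟨A'', g1, g2, g3⟩ := incr_aux F A' B' m ⌈ε * m⌉₊ h2 (fun i => (hB'B i).trans (hBA i)) hB'
        hc1 hc2 ε hε (Nat.le_ceil _) (ρ * (1 + ε ^ (Fintype.card ι) / 2) ^ j) (by positivity) h4 (by
          have hh : (cnt F B' : ℝ) ≤ cnt F B := by exact_mod_cast cnt_mono F hB'B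
          refine lt_of_le_of_lt hh (lt_of_lt_of_le hlow ?_)
          have := Nat.le_ceil (ε * (m : ℝ))
          gcongr
          nlinarith)
      refine ⟨A'', ⌈ε * m⌉₊, fun i => (g1 i).trans (h1 i), g2, ?_, ?_⟩
      · refine le_trans ?_ (Nat.le_ceil _)
        rw [pow_succ]; nlinarith
      · rw [pow_succ, ← mul_assoc]; exact g3
  obtain ⟨A', m, h1, h2, h3, h4⟩ := key N le_rfl
  have hm4 : (4 : ℝ) ≤ m := hm₀.trans h3
  have hle : (cnt F A' : ℝ) ≤ (m : ℝ) ^ (Fintype.card ι) := by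
    have : cnt F A' ≤ (Fintype.piFinset A').card := by
      unfold cnt
      refine Finset.card_le_card (fun f hf => ?_)
      rw [Fintype.mem_piFinset]; exact (Finset.mem_filter.1 hf).2
    rw [Fintype.card_piFinset] at this
    simp only [h2, prod_const, Finset.card_univ] at this
    exact_mod_cast this
  have hpos : 0 < (m : ℝ) ^ (Fintype.card ι) := by
    have : (0 : ℝ) < m := by linarith
    positivity
  nlinarith

theorem clean_aux {V ι : Type*} [Fintype ι] [DecidableEq ι] [DecidableEq V] [Fintype V]
    (F : Finset (ι → V)) (θ : ℕ)
    (hF : θ * (Fintype.card ι * Fintype.card V ^ (Fintype.card ι - 1)) < F.card) :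
    ∃ F' ⊆ F, F'.Nonempty ∧ ∀ f ∈ F', ∀ i,
      θ ≤ (univ.filter (fun v => Function.update f i v ∈ F')).card := by
  let bd : ι → Finset (ι → V) → ℕ := fun i G =>
    (G.image (fun f => fun x : {x : ι // x ≠ i} => f x)).card
  let pot : Finset (ι → V) → ℤ := fun G => (G.card : ℤ) - θ * ∑ i, (bd i G : ℤ)
  obtain ⟨F', hF', hmax⟩ := Finset.exists_max_image F.powerset pot ⟨F, by simp⟩
  rw [Finset.mem_powerset] at hF'
  refine ⟨F', hF', ?_, ?_⟩
  · rw [Finset.nonempty_iff_ne_empty]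
    rintro rfl
    have h1 := hmax F (by simp)
    have h2 : pot ∅ = 0 := by simp [pot, bd]
    rw [h2] at h1
    have h3 : ∑ i, bd i F ≤ Fintype.card ι * Fintype.card V ^ (Fintype.card ι - 1) := by
      calc ∑ i, bd i F ≤ ∑ i : ι, Fintype.card V ^ (Fintype.card ι - 1) := by
            refine Finset.sum_le_sum (fun i _ => ?_)
            refine (Finset.card_le_univ _).trans ?_
            rw [Fintype.card_fun, Fintype.card_subtype_compl]
            simp
        _ = _ := by simp
    have h4 : (θ : ℤ) * ∑ i, (bd i F : ℤ) < F.card := by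
      have : θ * ∑ i, bd i F < F.card := lt_of_le_of_lt (Nat.mul_le_mul_left _ h3) hF
      exact_mod_cast this
    simp only [pot] at h1
    linarith
  · intro f hf i
    by_contra hlt
    push Not at hlt
    let R := F'.filter (fun g => ∀ j, j ≠ i → g j = f j)
    have hRcard : R.card < θ := by
      refine lt_of_le_of_lt ?_ hlt
      refine Finset.card_le_card_of_injOn (fun g => g i) ?_ ?_
      · intro g hg
        have hg' := Finset.mem_filter.1 (Finset.mem_coe.1 hg)
        simp only [coe_filter, mem_univ, true_and]
        have : Function.update f i (g i) = g := by
          ext j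
          by_cases hj : j = i
          · subst hj; simp
          · rw [Function.update_of_ne hj, hg'.2 j hj]
        show Function.update f i (g i) ∈ F'
        rw [this]; exact hg'.1
      · intro g hg g' hg' heq
        have h1 := Finset.mem_filter.1 (Finset.mem_coe.1 hg)
        have h2 := Finset.mem_filter.1 (Finset.mem_coe.1 hg')
        ext j
        by_cases hj : j = i
        · subst hj; exact heq
        · rw [h1.2 j hj, h2.2 j hj]
    have h1 := hmax (F' \ R) (by rw [Finset.mem_powerset]; exact Finset.sdiff_subset.trans hF')
    have hb : ∀ j, bd j (F' \ R) ≤ bd j F' := fun j =>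
      Finset.card_le_card (Finset.image_subset_image Finset.sdiff_subset)
    have hbi : bd i (F' \ R) + 1 ≤ bd i F' := by
      have hmem : (fun x : {x : ι // x ≠ i} => f x) ∈
          F'.image (fun f => fun x : {x : ι // x ≠ i} => f x) := Finset.mem_image_of_mem _ hf
      have : (F' \ R).image (fun f => fun x : {x : ι // x ≠ i} => f x) ⊆
          (F'.image (fun f => fun x : {x : ι // x ≠ i} => f x)).erase
            (fun x : {x : ι // x ≠ i} => f x) := by
        intro y hy
        obtain ⟨g, hg, rfl⟩ := Finset.mem_image.1 hy
        rw [Finset.mem_sdiff] at hg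
        refine Finset.mem_erase.2 ⟨?_, Finset.mem_image_of_mem _ hg.1⟩
        intro heq
        apply hg.2
        exact Finset.mem_filter.2 ⟨hg.1, fun j hj => congrFun heq ⟨j, hj⟩⟩
      have h2 := Finset.card_le_card this
      rw [Finset.card_erase_of_mem hmem] at h2
      have h3 : 0 < (F'.image (fun f => fun x : {x : ι // x ≠ i} => f x)).card :=
        Finset.card_pos.2 ⟨_, hmem⟩
      simp only [bd]
      omega
    have hsum : ∑ j, (bd j (F' \ R) : ℤ) + 1 ≤ ∑ j, (bd j F' : ℤ) := by
      rw [← Finset.add_sum_erase univ _ (Finset.mem_univ i),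
        ← Finset.add_sum_erase univ (fun j => (bd j F' : ℤ)) (Finset.mem_univ i)]
      have h5 : ∑ x ∈ univ.erase i, (bd x (F' \ R) : ℤ) ≤ ∑ x ∈ univ.erase i, (bd x F' : ℤ) :=
        Finset.sum_le_sum (fun j _ => by exact_mod_cast hb j)
      have h6 : (bd i (F' \ R) : ℤ) + 1 ≤ bd i F' := by exact_mod_cast hbi
      linarith
    have hRsub : R ⊆ F' := Finset.filter_subset _ _
    have hcard : ((F' \ R).card : ℤ) = F'.card - R.card := by
      have := Finset.card_sdiff_add_card_eq_card hRsub
      have : (((F' \ R).card + R.card : ℕ) : ℤ) = F'.card := by rw [this]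
      push_cast at this; linarith
    simp only [pot] at h1
    rw [hcard] at h1
    have hR' : (R.card : ℤ) < θ := by exact_mod_cast hRcard
    nlinarith

theorem path_aux {V : Type*} [Fintype V] [DecidableEq V] {k : ℕ} (E : Finset (Finset V))
    (F : Finset (Fin k → V)) (θ : ℕ) (hne : F.Nonempty)
    (hFE : ∀ f ∈ F, univ.image f ∈ E) (hinj : ∀ f ∈ F, Function.Injective f)
    (hF : ∀ f ∈ F, ∀ i, θ ≤ (univ.filter (fun v => Function.update f i v ∈ F)).card)
    (B : Fin k → Finset V) (hB : ∀ f ∈ F, ∀ i, f i ∈ B i)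
    (c : ℕ → Fin k) (hc0 : Set.InjOn c (Set.Iio k)) (N : ℕ) (hkN : k ≤ N) (hN : N ≤ θ) :
    ∃ v : ℕ → V, Set.InjOn v (Set.Iio N) ∧ (∀ p < N, v p ∈ B (c p)) ∧
      ∀ a, a + k ≤ N → Set.InjOn c (Set.Ico a (a + k)) → (Finset.Ico a (a + k)).image v ∈ E := by
  have winE : ∀ (v : ℕ → V) (s : Fin k → V) (a : ℕ), s ∈ F → Set.InjOn c (Set.Ico a (a + k)) →
      (∀ p, a ≤ p → p < a + k → s (c p) = v p) → (Finset.Ico a (a + k)).image v ∈ E := by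
    intro v s a hs hcinj hsv
    have h1 : (Finset.Ico a (a + k)).image v = ((Finset.Ico a (a + k)).image c).image s := by
      rw [Finset.image_image]
      refine Finset.image_congr (fun p hp => ?_)
      simp only [coe_Ico, Set.mem_Ico] at hp
      exact (hsv p hp.1 hp.2).symm
    have h2 : (Finset.Ico a (a + k)).image c = univ := by
      apply Finset.eq_univ_of_card
      rw [Finset.card_image_of_injOn (by simpa using hcinj)]
      simp
    rw [h1, h2]; exact hFE s hs
  suffices h : ∃ v : ℕ → V, ∃ s ∈ F, Set.InjOn v (Set.Iio N) ∧ (∀ p < N, v p ∈ B (c p)) ∧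
      (∀ p < N, (∀ p', p < p' → p' < N → c p' ≠ c p) → s (c p) = v p) ∧
      ∀ a, a + k ≤ N → Set.InjOn c (Set.Ico a (a + k)) → (Finset.Ico a (a + k)).image v ∈ E by
    obtain ⟨v, s, _, h1, h2, _, h3⟩ := h
    exact ⟨v, h1, h2, h3⟩
  induction N, hkN using Nat.le_induction with
  | base =>
    obtain ⟨f, hf⟩ := hne
    refine ⟨fun p => f (c p), f, hf, ?_, ?_, ?_, ?_⟩
    · intro p hp p' hp' heq
      exact hc0 hp hp' (hinj f hf heq)
    · intro p _; exact hB f hf _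
    · intro p _ _; rfl
    · intro a _ hci
      exact winE _ f a hf hci (fun _ _ _ => rfl)
  | succ N hkN ih =>
    obtain ⟨v, s, hs, h1, h2, h3, h4⟩ := ih (by omega)
    have hex : ∃ w, Function.update s (c N) w ∈ F ∧ w ∉ (Finset.range N).image v := by
      by_contra hcon
      push Not at hcon
      have hsub : univ.filter (fun w => Function.update s (c N) w ∈ F) ⊆
          (Finset.range N).image v := fun w hw => hcon w (Finset.mem_filter.1 hw).2
      have h5 := Finset.card_le_card hsub
      have h6 := hF s hs (c N)
      have h7 : ((Finset.range N).image v).card ≤ N := by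
        simpa using Finset.card_image_le (s := Finset.range N) (f := v)
      omega
    obtain ⟨w, hwF, hw⟩ := hex
    have hwne : ∀ p < N, v p ≠ w := by
      intro p hp heq
      exact hw (Finset.mem_image.2 ⟨p, by simpa using hp, heq⟩)
    have hv' : ∀ p < N, Function.update v N w p = v p := fun p hp =>
      Function.update_of_ne (by omega) _ _
    have h3' : ∀ p < N + 1, (∀ p', p < p' → p' < N + 1 → c p' ≠ c p) →
        Function.update s (c N) w (c p) = Function.update v N w p := by
      intro p hp hlast
      by_cases hpN : p = N
      · subst hpN; simp
      · have hpN' : p < N := by omega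
        rw [hv' p hpN', Function.update_of_ne (hlast N hpN' (by omega)).symm]
        exact h3 p hpN' (fun p' h5 h6 => hlast p' h5 (by omega))
    refine ⟨Function.update v N w, Function.update s (c N) w, hwF, ?_, ?_, h3', ?_⟩
    · intro p hp p' hp' heq
      simp only [Set.mem_Iio] at hp hp'
      by_cases h5 : p = N <;> by_cases h6 : p' = N
      · omega
      · subst h5
        rw [hv' p' (by omega), Function.update_self] at heq
        exact absurd heq.symm (hwne p' (by omega))
      · subst h6
        rw [hv' p (by omega), Function.update_self] at heq
        exact absurd heq (hwne p (by omega))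
      · rw [hv' p (by omega), hv' p' (by omega)] at heq
        exact h1 (show p < N by omega) (show p' < N by omega) heq
    · intro p hp
      by_cases h5 : p = N
      · subst h5
        simpa using hB _ hwF (c p)
      · rw [hv' p (by omega)]; exact h2 p (by omega)
    · intro a ha hci
      by_cases h5 : a + k ≤ N
      · have := h4 a h5 hci
        have heq : (Finset.Ico a (a + k)).image (Function.update v N w) =
            (Finset.Ico a (a + k)).image v := by
          refine Finset.image_congr (fun p hp => ?_)
          simp only [coe_Ico, Set.mem_Ico] at hp
          exact hv' p (by omega)
        rw [heq]; exact this
      · refine winE _ _ a hwF hci (fun p hp1 hp2 => ?_)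
        refine h3' p (by omega) (fun p' h6 h7 h8 => ?_)
        have := hci (show p' ∈ Set.Ico a (a + k) from ⟨by omega, by omega⟩)
          (show p ∈ Set.Ico a (a + k) from ⟨hp1, hp2⟩) h8
        omega

theorem pattern_aux (k d : ℕ) (hd : 1 ≤ d) (hdk : d ≤ k) :
    ∃ (Lam : ℕ) (c : ℕ → Fin k) (i₀ : Fin k), 0 < Lam ∧ d ∣ Lam ∧ (∀ p, c (p + Lam) = c p) ∧
      (∀ a, Set.InjOn c (Set.Ico (a * d) (a * d + k))) ∧
      (k / d * d) * ((Finset.range Lam).filter (fun p => c p = i₀)).card = Lam := by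
  set q := k / d with hq
  set r := k % d with hr
  have hkqr : k = q * d + r := by rw [hq, hr, mul_comm]; exact (Nat.div_add_mod k d).symm
  have hrd : r < d := Nat.mod_lt _ hd
  have hq1 : 1 ≤ q := Nat.div_pos hdk hd
  have hqd : 0 < q * d := by positivity
  have hlt2 : ∀ p, p % d < r → p % ((q + 1) * d) < k := by
    intro p hp
    have h1 : p % ((q + 1) * d) % d = p % d := Nat.mod_mul_left_mod p (q + 1) d
    set y := p % ((q + 1) * d) with hy
    have h2 : y < (q + 1) * d := Nat.mod_lt _ (by positivity)
    have h3 : y / d ≤ q := Nat.lt_succ_iff.1 ((Nat.div_lt_iff_lt_mul hd).2 h2)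
    have h4 := Nat.div_add_mod y d
    have h5 : d * (y / d) ≤ q * d := by rw [mul_comm]; exact Nat.mul_le_mul_right _ h3
    omega
  have hlt1 : ∀ p, p % (q * d) < k := by
    intro p
    have := Nat.mod_lt p hqd
    omega
  let g : ℕ → ℕ := fun p => if p % d < r then p % ((q + 1) * d) else p % (q * d)
  have hg : ∀ p, g p < k := by
    intro p
    simp only [g]
    split_ifs with h
    · exact hlt2 p h
    · exact hlt1 p
  have hgd : ∀ p, g p % d = p % d := by
    intro p
    simp only [g]
    split_ifs with h
    · exact Nat.mod_mul_left_mod p (q + 1) d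
    · exact Nat.mod_mul_left_mod p q d
  refine ⟨q * (q + 1) * d, fun p => ⟨g p, hg p⟩, ⟨d - 1, by omega⟩, by positivity,
    Dvd.intro_left _ rfl, ?_, ?_, ?_⟩
  · intro p
    simp only [Fin.mk.injEq, g]
    have h1 : (p + q * (q + 1) * d) % d = p % d := by simp
    have h2 : (p + q * (q + 1) * d) % ((q + 1) * d) = p % ((q + 1) * d) := by
      rw [mul_assoc, Nat.add_mul_mod_self_right]
    have h3 : (p + q * (q + 1) * d) % (q * d) = p % (q * d) := by
      rw [show q * (q + 1) * d = (q + 1) * (q * d) by ring, Nat.add_mul_mod_self_right]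
    rw [h1, h2, h3]
  · intro a
    have key : ∀ p p', a * d ≤ p → p ≤ p' → p' < a * d + k → g p = g p' → p = p' := by
      intro p p' h1 h2 h3 h4
      have h5 : p % d = p' % d := by rw [← hgd p, ← hgd p', h4]
      by_contra hne
      have hpos : 0 < p' - p := by omega
      by_cases h6 : p % d < r
      · have h7 : p' % d < r := h5 ▸ h6
        simp only [g, h6, h7, if_true] at h4
        have h8 : (q + 1) * d ∣ p' - p := (Nat.modEq_iff_dvd' h2).1 h4
        have := Nat.le_of_dvd hpos h8
        have : (q + 1) * d = q * d + d := by ring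
        omega
      · have h7 : ¬ p' % d < r := h5 ▸ h6
        simp only [g, h6, h7, if_false] at h4
        have h8 : q * d ∣ p' - p := (Nat.modEq_iff_dvd' h2).1 h4
        have h9 := Nat.le_of_dvd hpos h8
        have h10 : p < a * d + r := by omega
        have h11 : p % d = p - a * d := by
          obtain ⟨e, rfl⟩ := Nat.exists_eq_add_of_le h1
          rw [show a * d + e = e + a * d by ring, Nat.add_mul_mod_self_right, Nat.mod_eq_of_lt (by omega)]
          omega
        omega
    intro p hp p' hp' heq
    simp only [Fin.mk.injEq] at heq
    simp only [Set.mem_Ico] at hp hp'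
    rcases le_total p p' with h | h
    · exact key p p' hp.1 h hp'.2 heq
    · exact (key p' p hp'.1 h hp.2 heq.symm).symm
  · have hset : ((Finset.range (q * (q + 1) * d)).filter
        (fun p => (⟨g p, hg p⟩ : Fin k) = ⟨d - 1, by omega⟩)) =
        (Finset.range (q + 1)).image (fun y => d - 1 + y * (q * d)) := by
      ext p
      simp only [mem_filter, mem_range, Fin.mk.injEq, mem_image]
      constructor
      · rintro ⟨h1, h2⟩
        have h3 : p % d = d - 1 := by
          rw [← hgd p, h2]; exact Nat.mod_eq_of_lt (by omega)
        have h4 : ¬ p % d < r := by omega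
        simp only [g, h4, if_false] at h2
        refine ⟨p / (q * d), ?_, ?_⟩
        · rw [Nat.div_lt_iff_lt_mul hqd]
          calc p < _ := h1
            _ = _ := by ring
        · rw [← h2]
          have := Nat.div_add_mod p (q * d)
          linarith
      · rintro ⟨y, hy, rfl⟩
        have hdle : d ≤ q * d := Nat.le_mul_of_pos_left d hq1
        constructor
        · have : (y + 1) * (q * d) ≤ (q + 1) * (q * d) := Nat.mul_le_mul_right _ hy
          have h8 : (y + 1) * (q * d) = y * (q * d) + q * d := by ring
          have h9 : (q + 1) * (q * d) = q * (q + 1) * d := by ring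
          omega
        · have h3 : (d - 1 + y * (q * d)) % d = d - 1 := by
            rw [← mul_assoc, Nat.add_mul_mod_self_right]; exact Nat.mod_eq_of_lt (by omega)
          have h4 : ¬ (d - 1 + y * (q * d)) % d < r := by omega
          simp only [g, h4, if_false]
          rw [Nat.add_mul_mod_self_right]; exact Nat.mod_eq_of_lt (by omega)
    rw [hset, Finset.card_image_of_injective, Finset.card_range]
    · ring
    · intro y y' h
      simp only [Nat.add_left_cancel_iff] at h
      exact Nat.eq_of_mul_eq_mul_right hqd h

theorem periodcount_aux {k : ℕ} (Lam : ℕ) (c : ℕ → Fin k) (hper : ∀ p, c (p + Lam) = c p) (i : Fin k)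
    (j ℓ : ℕ) : ((Finset.range (j * Lam + ℓ)).filter (fun p => c p = i)).card ≤
      j * ((Finset.range Lam).filter (fun p => c p = i)).card + ℓ := by
  have hper' : ∀ j p, c (p + j * Lam) = c p := by
    intro j
    induction j with
    | zero => simp
    | succ j ih => intro p; rw [Nat.succ_mul, ← add_assoc, hper, ih]
  have h1 : ∀ a b, ((Finset.range (a + b)).filter (fun p => c p = i)).card =
      ((Finset.range a).filter (fun p => c p = i)).card +
      ((Finset.range b).filter (fun p => c (p + a) = i)).card := by
    intro a b
    simp only [← Nat.count_eq_card_filter_range]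
    rw [Nat.count_add]
    simp only [add_comm]
  have h2 : ∀ j, ((Finset.range (j * Lam)).filter (fun p => c p = i)).card =
      j * ((Finset.range Lam).filter (fun p => c p = i)).card := by
    intro j
    induction j with
    | zero => simp
    | succ j ih =>
      rw [Nat.succ_mul, h1, ih]
      simp only [hper']
      ring
  rw [h1, h2]
  have : ((Finset.range ℓ).filter (fun p => c (p + j * Lam) = i)).card ≤ ℓ := by
    simpa using Finset.card_filter_le (Finset.range ℓ) (fun p => c (p + j * Lam) = i)
  omega

def FE {V : Type*} [Fintype V] [DecidableEq V] (k : ℕ) (E : Finset (Finset V)) :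
    Finset (Fin k → V) := univ.filter (fun f => univ.image f ∈ E)

theorem FE_inj {V : Type*} [Fintype V] [DecidableEq V] {k : ℕ} {E : Finset (Finset V)}
    (hE : ∀ e ∈ E, e.card = k) {f : Fin k → V} (hf : f ∈ FE k E) : Function.Injective f := by
  have hf' : univ.image f ∈ E := (Finset.mem_filter.1 hf).2
  have h2 : (univ.image f).card = (univ : Finset (Fin k)).card := by simpa using hE _ hf'
  exact fun a b hab => Finset.card_image_iff.1 h2 (by simp) (by simp) hab

theorem onepath_aux {V : Type*} [Fintype V] [DecidableEq V] {k ℓ : ℕ} (hℓk : ℓ < k)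
    (E : Finset (Finset V)) (hE : ∀ e ∈ E, e.card = k)
    (Lam : ℕ) (c : ℕ → Fin k) (hLam : 0 < Lam) (hdvd : (k - ℓ) ∣ Lam)
    (hwin : ∀ a, Set.InjOn c (Set.Ico (a * (k - ℓ)) (a * (k - ℓ) + k)))
    (θ j : ℕ) (hj : 1 ≤ j) (hθ : j * Lam + ℓ ≤ θ) (B : Fin k → Finset V)
    (hB : θ * (k * Fintype.card V ^ (k - 1)) < cnt (FE k E) B) :
    ∃ v : ℕ → V, IsLPathIn k ℓ E ((List.range (j * Lam + ℓ)).map v) ∧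
      ∀ p < j * Lam + ℓ, v p ∈ B (c p) := by
  obtain ⟨F', hF'sub, hne, hF'⟩ := clean_aux ((FE k E).filter (fun f => ∀ i, f i ∈ B i)) θ
    (by rw [Fintype.card_fin]; unfold cnt at hB; convert hB)
  have hF'1 : ∀ f ∈ F', f ∈ FE k E := fun f hf => (Finset.mem_filter.1 (hF'sub hf)).1
  have hF'2 : ∀ f ∈ F', ∀ i, f i ∈ B i := fun f hf => (Finset.mem_filter.1 (hF'sub hf)).2
  obtain ⟨m, hm⟩ := hdvd
  set d := k - ℓ with hd
  have hdpos : 0 < d := by omega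
  have hm1 : 1 ≤ m := by
    rcases Nat.eq_zero_or_pos m with h | h
    · subst h; omega
    · exact h
  have hjL : j * Lam = (j * m) * d := by rw [hm]; ring
  have hjm : 1 ≤ j * m := Nat.mul_pos hj hm1
  have hdle : d ≤ j * m * d := Nat.le_mul_of_pos_left d hjm
  obtain ⟨v, h1, h2, h3⟩ := path_aux E F' θ hne (fun f hf => (Finset.mem_filter.1 (hF'1 f hf)).2)
    (fun f hf => FE_inj hE (hF'1 f hf)) hF' B hF'2 c
    (by have := hwin 0; simpa [Set.Ico, Set.Iio] using this) (j * Lam + ℓ) (by omega) hθ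
  refine ⟨v, ⟨?_, ⟨j * m, hjm, ?_⟩, ?_⟩, h2⟩
  · refine List.Nodup.map_on ?_ List.nodup_range
    intro x hx y hy hxy
    exact h1 (List.mem_range.1 hx) (List.mem_range.1 hy) hxy
  · simp [hjL, hd]
  · intro e he
    unfold pathEdges at he
    obtain ⟨i, hi, rfl⟩ := Finset.mem_image.1 he
    simp only [List.length_map, List.length_range, Finset.mem_range, Nat.add_sub_cancel, ← hd] at hi
    rw [hjL, Nat.mul_div_cancel _ hdpos] at hi
    have hid : (i + 1) * d ≤ j * m * d := Nat.mul_le_mul_right _ hi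
    have hid2 : (i + 1) * d = i * d + d := by ring
    have hle : i * d + k ≤ j * Lam + ℓ := by omega
    have := h3 (i * d) hle (hwin i)
    convert this using 1
    ext w
    simp only [List.mem_toFinset, Finset.mem_image, Finset.mem_Ico, List.mem_take_iff_getElem,
      List.getElem_drop, List.getElem_map, List.getElem_range, List.length_drop, List.length_map,
      List.length_range, ← hd]
    constructor
    · rintro ⟨a, ha, rfl⟩
      exact ⟨i * d + a, ⟨by omega, by omega⟩, rfl⟩
    · rintro ⟨p, ⟨hp1, hp2⟩, rfl⟩
      exact ⟨p - i * d, by omega, by congr 1; omega⟩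

theorem tile_aux {V : Type*} [Fintype V] [DecidableEq V] {k ℓ : ℕ} (hℓk : ℓ < k)
    (E : Finset (Finset V)) (hE : ∀ e ∈ E, e.card = k)
    (Lam : ℕ) (c : ℕ → Fin k) (hLam : 0 < Lam) (hdvd : (k - ℓ) ∣ Lam)
    (hper : ∀ p, c (p + Lam) = c p)
    (hwin : ∀ a, Set.InjOn c (Set.Ico (a * (k - ℓ)) (a * (k - ℓ) + k)))
    (θ j : ℕ) (hj : 1 ≤ j) (hθ : j * Lam + ℓ ≤ θ) (A : Fin k → Finset V) (b : ℝ)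
    (hgood : ∀ B : Fin k → Finset V, (∀ i, B i ⊆ A i) → (∀ i, b ≤ (B i).card) →
      θ * (k * Fintype.card V ^ (k - 1)) < cnt (FE k E) B) (T : ℕ) :
    ∀ B : Fin k → Finset V, (∀ i, B i ⊆ A i) →
      (∀ i i', i ≠ i' → Disjoint (B i) (B i')) →
      (∀ i, (T : ℝ) * (j * ((Finset.range Lam).filter (fun p => c p = i)).card + ℓ) + b ≤
        (B i).card) →
      ∃ P : Finset (List V), P.card = T ∧ (∀ vs ∈ P, IsLPathIn k ℓ E vs) ∧
        (∀ vs ∈ P, ∀ ws ∈ P, vs ≠ ws → Disjoint vs.toFinset ws.toFinset) ∧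
        (∀ vs ∈ P, vs.length = j * Lam + ℓ) ∧
        (∀ vs ∈ P, vs.toFinset ⊆ univ.biUnion B) := by
  induction T with
  | zero => intro B _ _ _; exact ⟨∅, by simp⟩
  | succ T ih =>
    intro B hBA hdis hcard
    obtain ⟨v, hpath, hv⟩ := onepath_aux hℓk E hE Lam c hLam hdvd hwin θ j hj hθ B
      (hgood B hBA (fun i => le_trans (by
        have : (0 : ℝ) ≤ ((T + 1 : ℕ) : ℝ) *
          (j * ((Finset.range Lam).filter (fun p => c p = i)).card + ℓ) := by positivity
        linarith) (hcard i)))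
    set vs := (List.range (j * Lam + ℓ)).map v with hvs
    have hmem : ∀ w, w ∈ vs.toFinset ↔ ∃ p < j * Lam + ℓ, v p = w := by
      intro w; simp [hvs]
    obtain ⟨P, hP1, hP2, hP3, hP4, hP5⟩ := ih (fun i => B i \ vs.toFinset)
      (fun i => Finset.sdiff_subset.trans (hBA i))
      (fun i i' h => (hdis i i' h).mono Finset.sdiff_subset Finset.sdiff_subset)
      (by
        intro i
        have hsub : B i ∩ vs.toFinset ⊆
            ((Finset.range (j * Lam + ℓ)).filter (fun p => c p = i)).image v := by
          intro w hw
          obtain ⟨hw1, hw2⟩ := Finset.mem_inter.1 hw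
          obtain ⟨p, hp, rfl⟩ := (hmem w).1 hw2
          refine Finset.mem_image.2 ⟨p, Finset.mem_filter.2 ⟨by simpa using hp, ?_⟩, rfl⟩
          by_contra hne
          exact Finset.disjoint_left.1 (hdis _ _ hne) (hv p hp) hw1
        have h1 := (Finset.card_le_card hsub).trans
          (Finset.card_image_le.trans (periodcount_aux Lam c hper i j ℓ))
        have h2 : (B i \ vs.toFinset).card + (B i ∩ vs.toFinset).card = (B i).card :=
          Finset.card_sdiff_add_card_inter _ _
        have h3 := hcard i
        have h1' : ((B i ∩ vs.toFinset).card : ℝ) ≤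
          j * ((Finset.range Lam).filter (fun p => c p = i)).card + ℓ := by exact_mod_cast h1
        have h2' : ((B i \ vs.toFinset).card : ℝ) + (B i ∩ vs.toFinset).card = (B i).card := by
          exact_mod_cast h2
        push_cast at h3 ⊢
        linarith)
    have hdisj : ∀ ws ∈ P, Disjoint vs.toFinset ws.toFinset := by
      intro ws hws
      rw [Finset.disjoint_left]
      intro w hw hw2
      have := hP5 ws hws hw2
      simp only [Finset.mem_biUnion, Finset.mem_univ, true_and, Finset.mem_sdiff] at this
      obtain ⟨_, _, h⟩ := this
      exact h hw
    have hNpos : 0 < j * Lam + ℓ := by positivity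
    have hvsP : vs ∉ P := by
      intro h
      have h1 := hdisj vs h
      rw [Finset.disjoint_self_iff_empty] at h1
      have h2 : v 0 ∈ vs.toFinset := (hmem _).2 ⟨0, hNpos, rfl⟩
      rw [h1] at h2
      exact absurd h2 (Finset.notMem_empty _)
    refine ⟨insert vs P, ?_, ?_, ?_, ?_, ?_⟩
    · rw [Finset.card_insert_of_notMem hvsP, hP1]
    · intro ws hws
      rcases Finset.mem_insert.1 hws with rfl | h
      · exact hpath
      · exact hP2 ws h
    · intro ws hws ws' hws' hne
      rcases Finset.mem_insert.1 hws with rfl | h <;> rcases Finset.mem_insert.1 hws' with rfl | h'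
      · exact absurd rfl hne
      · exact hdisj _ h'
      · exact (hdisj _ h).symm
      · exact hP3 _ h _ h' hne
    · intro ws hws
      rcases Finset.mem_insert.1 hws with rfl | h
      · simp [hvs]
      · exact hP4 ws h
    · intro ws hws
      rcases Finset.mem_insert.1 hws with rfl | h
      · intro w hw
        obtain ⟨p, hp, rfl⟩ := (hmem w).1 hw
        exact Finset.mem_biUnion.2 ⟨c p, by simp, hv p hp⟩
      · refine (hP5 ws h).trans ?_
        intro w hw
        simp only [Finset.mem_biUnion, Finset.mem_univ, true_and, Finset.mem_sdiff] at hw ⊢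
        obtain ⟨i, hi, _⟩ := hw
        exact ⟨i, hi⟩

/-- disjoint subsets of prescribed sizes -/
theorem split_aux {V I : Type*} [DecidableEq V] [DecidableEq I] (J : Finset I) (s : I → ℕ) :
    ∀ Q : Finset V, ∑ i ∈ J, s i ≤ Q.card →
    ∃ C : I → Finset V, (∀ i ∈ J, C i ⊆ Q) ∧ (∀ i ∈ J, (C i).card = s i) ∧
      (∀ i ∈ J, ∀ i' ∈ J, i ≠ i' → Disjoint (C i) (C i')) := by
  induction J using Finset.induction_on with
  | empty => intro Q _; exact ⟨fun _ => ∅, by simp⟩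
  | insert a J ha ih =>
    intro Q hQ
    rw [Finset.sum_insert ha] at hQ
    obtain ⟨D, hDQ, hD⟩ := Finset.exists_subset_card_eq (show s a ≤ Q.card by omega)
    obtain ⟨C, h1, h2, h3⟩ := ih (Q \ D) (by rw [Finset.card_sdiff_of_subset hDQ]; omega)
    have hne : ∀ i ∈ J, i ≠ a := fun i hi h => ha (h ▸ hi)
    have hdis : ∀ i ∈ J, Disjoint D (C i) := fun i hi =>
      (Finset.disjoint_sdiff).mono_right (h1 i hi)
    refine ⟨Function.update C a D, ?_, ?_, ?_⟩
    · intro i hi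
      rcases Finset.mem_insert.1 hi with rfl | h
      · simpa using hDQ
      · rw [Function.update_of_ne (hne i h)]; exact (h1 i h).trans Finset.sdiff_subset
    · intro i hi
      rcases Finset.mem_insert.1 hi with rfl | h
      · simpa using hD
      · rw [Function.update_of_ne (hne i h)]; exact h2 i h
    · intro i hi i' hi' hii
      rcases Finset.mem_insert.1 hi with rfl | h <;> rcases Finset.mem_insert.1 hi' with rfl | h'
      · exact absurd rfl hii
      · rw [Function.update_self, Function.update_of_ne (hne i' h')]; exact hdis _ h'
      · rw [Function.update_self, Function.update_of_ne (hne i h)]; exact (hdis _ h).symm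
      · rw [Function.update_of_ne (hne i h), Function.update_of_ne (hne i' h')]
        exact h3 i h i' h' hii

theorem round_aux {V I : Type*} [Fintype V] [DecidableEq V] [Fintype I] [DecidableEq I]
    (A : I → Finset V) (u : I → ℕ) (K : ℕ) (hK : 0 < K)
    (hload : ∀ v, ∑ i ∈ univ.filter (fun i => v ∈ A i), u i ≤ K) :
    ∃ B : I → Finset V, (∀ i, B i ⊆ A i) ∧ (∀ i i', i ≠ i' → Disjoint (B i) (B i')) ∧
      ∀ i, (u i : ℝ) * ((A i).card / K - 2 ^ (Fintype.card I)) ≤ (B i).card := by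
  let prof : V → Finset I := fun v => univ.filter (fun i => v ∈ A i)
  let Q : Finset I → Finset V := fun J => univ.filter (fun v => prof v = J)
  have hsplit : ∀ J : Finset I, ∃ C : I → Finset V, (∀ i ∈ J, C i ⊆ Q J) ∧
      (∀ i ∈ J, (C i).card = u i * ((Q J).card / K)) ∧
      (∀ i ∈ J, ∀ i' ∈ J, i ≠ i' → Disjoint (C i) (C i')) := by
    intro J
    apply split_aux
    rw [← Finset.sum_mul]
    rcases Finset.eq_empty_or_nonempty (Q J) with h | ⟨v, hv⟩
    · simp [h]
    · have hJ : prof v = J := (Finset.mem_filter.1 hv).2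
      have := hload v
      calc (∑ i ∈ J, u i) * ((Q J).card / K) ≤ K * ((Q J).card / K) := by
            apply Nat.mul_le_mul_right; rw [← hJ]; exact this
        _ ≤ _ := Nat.mul_div_le _ _
  choose C h1 h2 h3 using hsplit
  have hBmem : ∀ i v, v ∈ univ.biUnion (fun J : Finset I => if i ∈ J then C J i else ∅) ↔
      i ∈ prof v ∧ v ∈ C (prof v) i := by
    intro i v
    simp only [Finset.mem_biUnion, Finset.mem_univ, true_and]
    constructor
    · rintro ⟨J, hJ⟩
      by_cases hi : i ∈ J
      · simp only [hi, if_true] at hJ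
        have : prof v = J := (Finset.mem_filter.1 (h1 J i hi hJ)).2
        rw [this]; exact ⟨hi, hJ⟩
      · simp [hi] at hJ
    · rintro ⟨ha, hb⟩
      exact ⟨prof v, by simpa [ha] using hb⟩
  refine ⟨fun i => univ.biUnion (fun J : Finset I => if i ∈ J then C J i else ∅), ?_, ?_, ?_⟩
  · intro i v hv
    exact (Finset.mem_filter.1 ((hBmem i v).1 hv).1).2
  · intro i i' hii
    rw [Finset.disjoint_left]
    intro v hv hv'
    have a1 := (hBmem i v).1 hv
    have a2 := (hBmem i' v).1 hv'
    exact Finset.disjoint_left.1 (h3 _ i a1.1 i' a2.1 hii) a1.2 a2.2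
  · intro i
    have hBcard : (univ.biUnion (fun J : Finset I => if i ∈ J then C J i else ∅)).card =
        ∑ J : Finset I, (if i ∈ J then C J i else ∅).card := by
      apply Finset.card_biUnion
      intro J _ J' _ hJJ
      rw [Function.onFun, Finset.disjoint_left]
      intro v hv hv'
      by_cases hi : i ∈ J <;> by_cases hi' : i ∈ J' <;> simp only [hi, hi', if_true, if_false] at hv hv'
      · exact hJJ (((Finset.mem_filter.1 (h1 J i hi hv)).2).symm.trans
          (Finset.mem_filter.1 (h1 J' i hi' hv')).2)
      all_goals simp at hv hv'
    have hAcard : (A i).card = ∑ J : Finset I, (if i ∈ J then (Q J).card else 0) := by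
      rw [Finset.card_eq_sum_card_fiberwise (f := prof) (t := univ) (by intro v _; simp)]
      refine Finset.sum_congr rfl (fun J _ => ?_)
      by_cases hi : i ∈ J
      · simp only [hi, if_true]
        congr 1
        ext v
        simp only [Q, Finset.mem_filter, Finset.mem_univ, true_and]
        refine ⟨fun h => h.2, fun h => ⟨?_, h⟩⟩
        rw [← h] at hi
        exact (Finset.mem_filter.1 hi).2
      · simp only [hi, if_false]
        rw [Finset.card_eq_zero, Finset.filter_eq_empty_iff]
        intro v hv hp
        apply hi
        rw [← hp]
        exact Finset.mem_filter.2 ⟨by simp, hv⟩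
    have hKr : (0 : ℝ) < K := by exact_mod_cast hK
    simp only
    rw [hBcard, hAcard]
    push_cast
    have h5 : (2 : ℝ) ^ (Fintype.card I) = ∑ J : Finset I, 1 := by simp
    rw [h5, Finset.sum_div, ← Finset.sum_sub_distrib, Finset.mul_sum]
    refine Finset.sum_le_sum (fun J _ => ?_)
    by_cases hi : i ∈ J
    · simp only [hi, if_true]
      rw [h2 J i hi]
      push_cast
      have h6 : ((Q J).card : ℝ) / K - 1 ≤ (((Q J).card / K : ℕ) : ℝ) := by
        have h7 := Nat.lt_div_mul_add (a := (Q J).card) hK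
        have h8 : ((Q J).card : ℝ) < ((Q J).card / K : ℕ) * K + K := by exact_mod_cast h7
        rw [sub_le_iff_le_add, div_le_iff₀ hKr]
        linarith
      gcongr
    · simp only [hi, if_false]
      simp

theorem lowsum_aux {V : Type*} [Fintype V] [DecidableEq V] (g : V → ℝ) (K κ : ℝ)
    (hg0 : ∀ v, 0 ≤ g v) (hgK : ∀ v, g v ≤ K) (t m₀ : ℕ) (hκ : (m₀ : ℝ) ≤ κ * Fintype.card V)
    (hm₀ : 1 ≤ m₀) (hm₀t : m₀ ≤ Fintype.card V / t) :
    ∃ (X₀ X : Finset V) (a z : ℝ), X₀ ⊆ X ∧ X₀.card = m₀ ∧ X.card = Fintype.card V / t ∧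
      (∀ v ∈ X₀, g v ≤ a) ∧ (∀ v ∈ X, g v ≤ z) ∧ (∀ v, v ∉ X → z ≤ g v) ∧
      Fintype.card V * (a + (t - 1) * z) ≤ t * (∑ v, g v + κ * K * Fintype.card V) := by
  set n := Fintype.card V with hn
  obtain ⟨X, -, hXc, hX⟩ := low_aux g univ (n / t) (by rw [Finset.card_univ]; exact Nat.div_le_self _ _)
  obtain ⟨X₀, hX₀X, hX₀c, hX₀⟩ := low_aux g X m₀ (by omega)
  have hne₀ : X₀.Nonempty := Finset.card_pos.1 (by omega)
  have hne : X.Nonempty := hne₀.mono hX₀X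
  obtain ⟨va, hva, hmaxa⟩ := Finset.exists_max_image X₀ g hne₀
  obtain ⟨vz, hvz, hmaxz⟩ := Finset.exists_max_image X g hne
  refine ⟨X₀, X, g va, g vz, hX₀X, hX₀c, hXc, hmaxa, hmaxz,
    fun v hv => hX vz hvz v (by simp) hv, ?_⟩
  have haz : g va ≤ g vz := hmaxz va (hX₀X hva)
  have hs1 : ∑ v, g v = ∑ v ∈ Xᶜ, g v + (∑ v ∈ X \ X₀, g v + ∑ v ∈ X₀, g v) := by
    rw [Finset.sum_sdiff hX₀X, Finset.sum_compl_add_sum]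
  have h1 : (Xᶜ.card : ℝ) * g vz ≤ ∑ v ∈ Xᶜ, g v := by
    rw [← nsmul_eq_mul]
    exact Finset.card_nsmul_le_sum _ _ _ (fun v hv => hX vz hvz v (by simp) (Finset.mem_compl.1 hv))
  have h2 : ((X \ X₀).card : ℝ) * g va ≤ ∑ v ∈ X \ X₀, g v := by
    rw [← nsmul_eq_mul]
    refine Finset.card_nsmul_le_sum _ _ _ (fun v hv => ?_)
    rw [Finset.mem_sdiff] at hv
    exact hX₀ va hva v hv.1 hv.2
  have h3 : 0 ≤ ∑ v ∈ X₀, g v := Finset.sum_nonneg (fun v _ => hg0 v)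
  have h4 : (Xᶜ.card : ℝ) + X.card = n := by
    rw [← Nat.cast_add, add_comm, Finset.card_add_card_compl]
  have h5 : ((X \ X₀).card : ℝ) + m₀ = X.card := by
    rw [← hX₀c, ← Nat.cast_add, Finset.card_sdiff_add_card_eq_card hX₀X]
  have h6 : (t : ℝ) * X.card ≤ n := by
    rw [hXc]; exact_mod_cast Nat.mul_div_le n t
  have h7 : (m₀ : ℝ) * g va ≤ κ * K * n := by
    have : 0 ≤ κ * n := le_trans (Nat.cast_nonneg _) hκ
    nlinarith [hg0 va, hgK va]
  have h8 : (X.card : ℝ) * g va + (n - X.card) * g vz ≤ ∑ v, g v + κ * K * n := by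
    rw [hs1]
    have e1 : (Xᶜ.card : ℝ) = n - X.card := by linarith
    have e2 : ((X \ X₀).card : ℝ) = X.card - m₀ := by linarith
    rw [e1] at h1; rw [e2] at h2
    linarith
  have h9 : (0 : ℝ) ≤ t := Nat.cast_nonneg _
  have h10 := mul_le_mul_of_nonneg_left h8 h9
  nlinarith [mul_nonneg (sub_nonneg.2 h6) (sub_nonneg.2 haz)]

def tw {V : Type*} [DecidableEq V] {k : ℕ} (u : Fin k → ℕ) (A : Fin k → Finset V) (v : V) : ℕ :=
  ∑ i, if v ∈ A i then u i else 0

theorem tw_le {V : Type*} [DecidableEq V] {k : ℕ} (u : Fin k → ℕ) (A : Fin k → Finset V) (v : V) :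
    tw u A v ≤ ∑ i, u i := by
  unfold tw
  refine Finset.sum_le_sum (fun i _ => ?_)
  split_ifs <;> omega

theorem tw_sum {V : Type*} [Fintype V] [DecidableEq V] {k : ℕ} (u : Fin k → ℕ)
    (A : Fin k → Finset V) (h : V → ℝ) :
    ∑ v, h v * (tw u A v : ℝ) = ∑ i, (u i : ℝ) * ∑ v ∈ A i, h v := by
  unfold tw
  push_cast
  simp only [Finset.mul_sum]
  rw [Finset.sum_comm]
  refine Finset.sum_congr rfl (fun i _ => ?_)
  rw [← Finset.sum_filter_add_sum_filter_not univ (fun v => v ∈ A i)]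
  have h2 : ∑ x ∈ univ.filter (fun v => v ∉ A i), h x * (if x ∈ A i then (u i : ℝ) else 0) = 0 := by
    refine Finset.sum_eq_zero (fun x hx => ?_)
    simp [(Finset.mem_filter.1 hx).2]
  rw [h2, add_zero]
  rw [show univ.filter (fun v => v ∈ A i) = A i by ext; simp]
  refine Finset.sum_congr rfl (fun x hx => ?_)
  simp [hx, mul_comm]

def load {V : Type*} [DecidableEq V] {k : ℕ} (u : Fin k → ℕ) (L : List (Fin k → Finset V)) (v : V) :
    ℕ := (L.map (fun A => tw u A v)).sum

def mass {V : Type*} [DecidableEq V] {k : ℕ} (i₀ : Fin k) (L : List (Fin k → Finset V)) : ℕ :=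
  (L.map (fun A => (A i₀).card)).sum

set_option maxHeartbeats 2000000 in
theorem process_aux {V : Type*} [Fintype V] [DecidableEq V] {k : ℕ} (u : Fin k → ℕ) (i₀ : Fin k)
    (t K m₀ : ℕ) (κ β γ : ℝ) (ht : 2 ≤ t) (hLam : t * u i₀ = ∑ i, u i) (hu : 0 < u i₀)
    (hn : 0 < Fintype.card V)
    (hβ : 0 < β)
    (hK : 0 < K) (hγ : 0 < γ) (hκ0 : 0 ≤ κ)
    (hκ : (m₀ : ℝ) ≤ κ * Fintype.card V)
    (hm₀ : 1 ≤ m₀) (hm₀t : m₀ ≤ Fintype.card V / t)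
    (hK1 : ((∑ i, u i : ℕ) : ℝ) ≤ β / 4 * K)
    (hK2 : 2 * κ + ((∑ i, u i : ℕ) : ℝ) / K < β ^ 2 / 32)
    (Good : (Fin k → Finset V) → Prop)
    (hstep : ∀ X₀ X : Finset V, X₀ ⊆ X → X₀.card = m₀ → X.card = Fintype.card V / t →
      ∃ A : Fin k → Finset V, Good A ∧ (∀ i, (A i).card = (A i₀).card) ∧
        γ * Fintype.card V ≤ (A i₀).card ∧ A i₀ ⊆ X₀ ∧ ∀ i, A i ⊆ X) :
    ∃ L : List (Fin k → Finset V),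
      (∀ A ∈ L, Good A ∧ (∀ i, (A i).card = (A i₀).card)) ∧
      (∀ v, load u L v ≤ K) ∧
      (L.length : ℝ) * γ * ((∑ i, u i : ℕ) : ℝ) ≤ K ∧
      ((∑ i, u i : ℕ) : ℝ) * mass i₀ L ≤ Fintype.card V * K ∧
      (1 - β / 2) * Fintype.card V * K ≤ ((∑ i, u i : ℕ) : ℝ) * mass i₀ L := by
  set n := Fintype.card V with hnn
  set Lam := ∑ i, u i with hLamdef
  have hnr : (0 : ℝ) < n := by exact_mod_cast hn
  have hKr : (0 : ℝ) < K := by exact_mod_cast hK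
  have htr : (2 : ℝ) ≤ t := by exact_mod_cast ht
  have hur : (0 : ℝ) < u i₀ := by exact_mod_cast hu
  have hLr : (t : ℝ) * u i₀ = Lam := by exact_mod_cast hLam
  have hLpos : (0 : ℝ) < Lam := by rw [← hLr]; positivity
  let Inv : List (Fin k → Finset V) → Prop := fun L =>
    (∀ A ∈ L, Good A ∧ (∀ i, (A i).card = (A i₀).card)) ∧
    (∀ A ∈ L, γ * n ≤ (A i₀).card) ∧
    (∀ v, load u L v ≤ K) ∧
    (∑ v, (load u L v : ℝ) = Lam * mass i₀ L) ∧
    (∑ v, (load u L v : ℝ) ^ 2 ≤ (Lam * mass i₀ L : ℝ) ^ 2 / n +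
      (2 * κ * K + Lam) * (Lam * mass i₀ L))
  have hlen : ∀ L, Inv L → (L.length : ℝ) * γ * Lam ≤ K ∧ (Lam : ℝ) * mass i₀ L ≤ n * K := by
    rintro L ⟨h1', h2, h3, h4, h5'⟩
    have h5 : (L.length : ℝ) * (γ * n) ≤ mass i₀ L := by
      clear h1' h3 h4 h5'
      induction L with
      | nil => simp [mass]
      | cons A L ih =>
        have := ih (fun A hA => h2 A (List.mem_cons_of_mem _ hA))
        have h6 := h2 A List.mem_cons_self
        have hmm : mass i₀ (A :: L) = (A i₀).card + mass i₀ L := by simp [mass]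
        rw [hmm, List.length_cons, Nat.cast_add, Nat.cast_add, Nat.cast_one, add_mul, one_mul]
        linarith
    have h6 : ∑ v, (load u L v : ℝ) ≤ n * K := by
      calc ∑ v, (load u L v : ℝ) ≤ ∑ v : V, (K : ℝ) :=
            Finset.sum_le_sum (fun v _ => by exact_mod_cast h3 v)
        _ = n * K := by simp [hnn]
    rw [h4] at h6
    have h7 : n * ((L.length : ℝ) * γ * Lam) ≤ n * K := by
      refine le_trans ?_ h6
      have := mul_le_mul_of_nonneg_left h5 hLpos.le
      linarith
    exact ⟨le_of_mul_le_mul_left h7 hnr, h6⟩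
  have hInv0 : Inv [] := by
    refine ⟨by simp, by simp, by simp [load], by simp [load, mass], by simp [load, mass]⟩
  -- a maximal list
  obtain ⟨L, hL, hLmax⟩ : ∃ L, Inv L ∧ ∀ A, ¬ Inv (A :: L) := by
    by_contra hcon
    push Not at hcon
    have hall : ∀ N : ℕ, ∃ L, Inv L ∧ L.length = N := by
      intro N
      induction N with
      | zero => exact ⟨[], hInv0, rfl⟩
      | succ N ih =>
        obtain ⟨L, hL, hl⟩ := ih
        obtain ⟨A, hA⟩ := hcon L hL
        exact ⟨A :: L, hA, by simp [hl]⟩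
    obtain ⟨N, hN⟩ := exists_nat_gt ((K : ℝ) / (γ * Lam))
    obtain ⟨L, hL, hl⟩ := hall N
    have h1 := (hlen L hL).1
    rw [hl] at h1
    rw [div_lt_iff₀ (by positivity)] at hN
    linarith
  refine ⟨L, hL.1, hL.2.2.1, (hlen L hL).1, (hlen L hL).2, ?_⟩
  obtain ⟨hI1, hI2, hI3, hI4, hI5⟩ := hL
  obtain ⟨X₀, X, a, z, hXX, hX₀c, hXc, ha, hz, hzout, hsum⟩ := lowsum_aux
    (fun v => (load u L v : ℝ)) K κ (fun v => Nat.cast_nonneg _)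
    (fun v => by exact_mod_cast hI3 v) t m₀ hκ hm₀ hm₀t
  rw [hI4] at hsum
  set S : ℝ := Lam * mass i₀ L with hS
  have hS0 : 0 ≤ S := by positivity
  have hzK : (K : ℝ) - Lam < z := by
    by_contra hle
    push Not at hle
    obtain ⟨A, hA1, hA2, hA3, hA4, hA5⟩ := hstep X₀ X hXX hX₀c hXc
    apply hLmax A
    have hload : ∀ v, load u (A :: L) v = tw u A v + load u L v := fun v => by simp [load]
    have hmass : mass i₀ (A :: L) = (A i₀).card + mass i₀ L := by simp [mass]
    have htw1 : ∑ v, (tw u A v : ℝ) = Lam * (A i₀).card := by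
      have := tw_sum u A (fun _ => 1)
      simp only [one_mul, Finset.sum_const, nsmul_eq_mul, mul_one, hA2, ← Finset.sum_mul] at this
      rw [this, hLamdef]; push_cast; rfl
    have htwz : ∀ v, v ∉ X → tw u A v = 0 := by
      intro v hv
      unfold tw
      refine Finset.sum_eq_zero (fun i _ => ?_)
      rw [if_neg (fun h => hv (hA5 i h))]
    refine ⟨?_, ?_, ?_, ?_, ?_⟩
    · intro A' hA'
      rcases List.mem_cons.1 hA' with rfl | h
      · exact ⟨hA1, hA2⟩
      · exact hI1 A' h
    · intro A' hA'
      rcases List.mem_cons.1 hA' with rfl | h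
      · exact hA3
      · exact hI2 A' h
    · intro v
      rw [hload]
      by_cases hv : v ∈ X
      · have h1 := hz v hv
        have h2 := tw_le u A v
        have h2' : (tw u A v : ℝ) ≤ Lam := by exact_mod_cast h2
        have h3 : (tw u A v : ℝ) + load u L v ≤ K := by
          linarith
        exact_mod_cast h3
      · rw [htwz v hv, zero_add]; exact hI3 v
    · simp only [hload, hmass]
      push_cast
      rw [Finset.sum_add_distrib, htw1, hI4]
      ring
    · simp only [hload, hmass]
      push_cast
      set m : ℝ := ((A i₀).card : ℝ) with hm
      have hm0 : 0 ≤ m := Nat.cast_nonneg _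
      have hcross : ∑ v, (load u L v : ℝ) * tw u A v ≤ m * (u i₀ * (a + (t - 1) * z)) := by
        rw [tw_sum]
        have hi : ∀ i, ∑ v ∈ A i, (load u L v : ℝ) ≤ m * (if i = i₀ then a else z) := by
          intro i
          have h1 : ∑ v ∈ A i, (load u L v : ℝ) ≤ (A i).card • (if i = i₀ then a else z) := by
            refine Finset.sum_le_card_nsmul _ _ _ (fun v hv => ?_)
            split_ifs with h
            · subst h; exact ha v (hA4 hv)
            · exact hz v (hA5 i hv)
          rw [nsmul_eq_mul, hA2] at h1
          exact h1
        calc ∑ i, (u i : ℝ) * ∑ v ∈ A i, (load u L v : ℝ)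
            ≤ ∑ i, (u i : ℝ) * (m * (if i = i₀ then a else z)) :=
              Finset.sum_le_sum (fun i _ => mul_le_mul_of_nonneg_left (hi i) (Nat.cast_nonneg _))
          _ = m * (u i₀ * (a + (t - 1) * z)) := by
              have h1 : ∀ i, (u i : ℝ) * (m * (if i = i₀ then a else z)) =
                  m * z * u i + (if i = i₀ then m * (a - z) * u i else 0) := by
                intro i; split_ifs <;> ring
              simp only [h1, Finset.sum_add_distrib, ← Finset.mul_sum, Finset.sum_ite_eq',
                Finset.mem_univ, if_true]
              rw [← Nat.cast_sum, ← hLamdef, ← hLr]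
              ring
      have hcross2 : n * ∑ v, (load u L v : ℝ) * tw u A v ≤ m * Lam * (S + κ * K * n) := by
        have h1 := mul_le_mul_of_nonneg_left hcross hnr.le
        have h2 := mul_le_mul_of_nonneg_left hsum (show 0 ≤ m * u i₀ by positivity)
        have h3 : m * u i₀ * (t * (S + κ * K * n)) = m * Lam * (S + κ * K * n) := by
          rw [← hLr]; ring
        rw [h3] at h2
        linarith
      have hcross3 : ∑ v, (load u L v : ℝ) * tw u A v ≤ m * Lam * S / n + m * Lam * κ * K := by
        rw [← sub_le_iff_le_add, le_div_iff₀ hnr]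
        linarith
      have hsq : ∑ v, (tw u A v : ℝ) ^ 2 ≤ Lam * (Lam * m) := by
        rw [← htw1, Finset.mul_sum]
        refine Finset.sum_le_sum (fun v _ => ?_)
        rw [sq]
        exact mul_le_mul_of_nonneg_right (by exact_mod_cast tw_le u A v) (Nat.cast_nonneg _)
      have hexp : ∑ v, ((tw u A v : ℝ) + load u L v) ^ 2 = ∑ v, (load u L v : ℝ) ^ 2 +
          2 * ∑ v, (load u L v : ℝ) * tw u A v + ∑ v, (tw u A v : ℝ) ^ 2 := by
        rw [Finset.mul_sum, ← Finset.sum_add_distrib, ← Finset.sum_add_distrib]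
        refine Finset.sum_congr rfl (fun v _ => ?_)
        ring
      rw [hexp]
      have hgoal : (Lam * (m + mass i₀ L) : ℝ) ^ 2 / n = S ^ 2 / n + 2 * (m * Lam * S / n) +
          (Lam * m) ^ 2 / n := by
        rw [hS]; ring
      have hnn2 : 0 ≤ (Lam * m) ^ 2 / n := by positivity
      rw [hgoal]
      have hd : (Lam : ℝ) * (m + mass i₀ L) = Lam * m + S := by rw [hS]; ring
      rw [hd]
      nlinarith
  -- conclude
  by_contra hlt
  push Not at hlt
  have hμ : S / n < (1 - β / 2) * K := by
    rw [div_lt_iff₀ hnr]; linarith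
  set μ := S / n with hμdef
  have hvar : ∑ v, ((load u L v : ℝ) - μ) ^ 2 ≤ (2 * κ * K + Lam) * S := by
    have hexp : ∑ v, ((load u L v : ℝ) - μ) ^ 2 = ∑ v, (load u L v : ℝ) ^ 2 -
          2 * μ * ∑ v, (load u L v : ℝ) + n * μ ^ 2 := by
      have hc : (n : ℝ) * μ ^ 2 = ∑ v : V, μ ^ 2 := by simp [hnn]
      rw [hc, Finset.mul_sum, ← Finset.sum_sub_distrib, ← Finset.sum_add_distrib]
      refine Finset.sum_congr rfl (fun v _ => ?_)
      ring
    rw [hexp, hI4]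
    have h1 : S = n * μ := by rw [hμdef]; field_simp
    have h2 : S ^ 2 / n = n * μ ^ 2 := by rw [h1]; field_simp
    have h3 : 2 * μ * S = 2 * (n * μ ^ 2) := by rw [h1]; ring
    rw [h2] at hI5
    rw [h3]
    linarith
  have hSK : S ≤ n * K := by
    have h1 : S = n * μ := by rw [hμdef]; field_simp
    rw [h1]
    refine mul_le_mul_of_nonneg_left ?_ hnr.le
    nlinarith
  have hlow : (n / 2 : ℝ) * (β / 4 * K) ^ 2 ≤ ∑ v, ((load u L v : ℝ) - μ) ^ 2 := by
    have h1 : (Xᶜ.card : ℝ) * (β / 4 * K) ^ 2 ≤ ∑ v ∈ Xᶜ, ((load u L v : ℝ) - μ) ^ 2 := by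
      rw [← nsmul_eq_mul]
      refine Finset.card_nsmul_le_sum _ _ _ (fun v hv => ?_)
      have h2 := hzout v (Finset.mem_compl.1 hv)
      have h3 : β / 4 * K ≤ (load u L v : ℝ) - μ := by nlinarith
      gcongr
    have h2 : ∑ v ∈ Xᶜ, ((load u L v : ℝ) - μ) ^ 2 ≤ ∑ v, ((load u L v : ℝ) - μ) ^ 2 :=
      Finset.sum_le_sum_of_subset_of_nonneg (Finset.subset_univ _) (fun _ _ _ => sq_nonneg _)
    have h3 : (n / 2 : ℝ) ≤ Xᶜ.card := by
      have h4 : (Xᶜ.card : ℝ) + X.card = n := by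
        rw [← Nat.cast_add, add_comm, Finset.card_add_card_compl]
      have h6 : (t : ℝ) * X.card ≤ n := by
        rw [hXc]; exact_mod_cast Nat.mul_div_le n t
      have h7 : (2 : ℝ) * X.card ≤ t * X.card := by gcongr
      linarith
    calc (n / 2 : ℝ) * (β / 4 * K) ^ 2 ≤ (Xᶜ.card : ℝ) * (β / 4 * K) ^ 2 := by gcongr
      _ ≤ _ := h1.trans h2
  have hfin : (n / 2 : ℝ) * (β / 4 * K) ^ 2 ≤ (2 * κ * K + Lam) * (n * K) := by
    refine hlow.trans (hvar.trans ?_)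
    gcongr
  have hK2' : (2 * κ * K + Lam) < β ^ 2 / 32 * K := by
    have := mul_lt_mul_of_pos_right hK2 hKr
    rw [add_mul, div_mul_cancel₀ _ hKr.ne'] at this
    exact this
  have h9 := mul_lt_mul_of_pos_right hK2' (show (0 : ℝ) < n * K by positivity)
  nlinarith

theorem edge_at_aux {V : Type*} [Fintype V] [DecidableEq V] {k : ℕ} (E : Finset (Finset V))
    (hE : ∀ e ∈ E, e.card = k) (v : V) (hv : 1 ≤ degH E {v}) (i₀ : Fin k) :
    ∃ f ∈ FE k E, f i₀ = v := by
  obtain ⟨e, he⟩ := Finset.card_pos.1 (show 0 < (E.filter (fun e => {v} ⊆ e)).card from hv)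
  rw [Finset.mem_filter, Finset.singleton_subset_iff] at he
  let g := (e.equivFinOfCardEq (hE e he.1)).symm
  let σ := Equiv.swap i₀ (g.symm ⟨v, he.2⟩)
  refine ⟨fun i => (g (σ i) : V), ?_, ?_⟩
  · rw [FE, Finset.mem_filter]
    refine ⟨Finset.mem_univ _, ?_⟩
    have : univ.image (fun i => (g (σ i) : V)) = e := by
      ext w
      simp only [Finset.mem_image, Finset.mem_univ, true_and]
      constructor
      · rintro ⟨i, rfl⟩; exact (g (σ i)).2
      · intro hw
        exact ⟨σ.symm (g.symm ⟨w, hw⟩), by simp⟩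
    rw [this]; exact he.1
  · simp [σ]

theorem dense_aux {V : Type*} [Fintype V] [DecidableEq V] {k : ℕ} (E : Finset (Finset V))
    (hE : ∀ e ∈ E, e.card = k) (t : ℕ) (ht : 2 ≤ t) (α : ℝ) (hα : 0 < α)
    (hdeg : (1 - 1 / (t : ℝ)) * Fintype.card V + α * Fintype.card V ≤ (posCodeg k E : ℝ))
    (hiso : ∀ v, 1 ≤ degH E {v}) (i₀ : Fin k) (hn : 2 ≤ α * Fintype.card V)
    (X₀ X : Finset V) (hX : X.card = Fintype.card V / t) :
    (α / 2) ^ (k - 1) * ∏ i, (((if i = i₀ then X₀ else X : Finset V)).card : ℝ) ≤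
      cnt (FE k E) (fun i => if i = i₀ then X₀ else X) := by
  set n := Fintype.card V with hnn
  set D := ⌈α * n / 2⌉₊ with hD
  have hF : ∀ f ∈ FE k E, ∀ i, D ≤ (X.filter (fun v => Function.update f i v ∈ FE k E)).card := by
    intro f hf i
    have h1 := codeg_aux E hE f (Finset.mem_filter.1 hf).2 i
    set Y := univ.filter (fun v => univ.image (Function.update f i v) ∈ E) with hY
    have h2 : X.filter (fun v => Function.update f i v ∈ FE k E) = X ∩ Y := by
      ext v; simp [FE, hY]
    rw [h2]
    have h3 := Finset.card_union_add_card_inter X Y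
    have h4 : (X ∪ Y).card ≤ n := Finset.card_le_univ _
    have h5 : (X.card : ℝ) + Y.card ≤ n + (X ∩ Y).card := by
      have : X.card + Y.card ≤ n + (X ∩ Y).card := by omega
      exact_mod_cast this
    have h6 : (posCodeg k E : ℝ) ≤ Y.card := by exact_mod_cast h1
    have h7 : (n : ℝ) / t - 1 ≤ X.card := by
      rw [hX]
      have h8 : n < t * (n / t + 1) := Nat.lt_mul_div_succ n (by omega)
      have h9 : (n : ℝ) ≤ t * ((n / t : ℕ) + 1 : ℝ) := by exact_mod_cast h8.le
      have h10 : (n : ℝ) / t ≤ (n / t : ℕ) + 1 := by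
        rw [div_le_iff₀ (by positivity)]; linarith
      linarith
    rw [hD, Nat.ceil_le]
    have h8 : (1 - 1 / (t : ℝ)) * n = n - n / t := by ring
    linarith
  have hX₀ : ∀ v ∈ X₀, D ^ (k - 1) ≤
      ((FE k E).filter (fun f => f i₀ = v ∧ ∀ i, i ≠ i₀ → f i ∈ X)).card := by
    intro v _
    obtain ⟨f, hf, hfv⟩ := edge_at_aux E hE v (hiso v) i₀
    have h1 := count_aux (FE k E) X D hF (univ.erase i₀) f hf
    rw [Finset.card_erase_of_mem (by simp)] at h1
    simp only [Finset.card_univ, Fintype.card_fin] at h1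
    have h2 : D ^ (k - 1) ≤ ((FE k E).filter (fun g => (∀ i, i ∉ univ.erase i₀ → g i = f i) ∧
        ∀ i ∈ univ.erase i₀, g i ∈ X)).card := by
      refine h1.trans (le_of_eq ?_)
      congr
    refine h2.trans (Finset.card_le_card (fun g hg => ?_))
    replace hg := Finset.mem_filter.1 hg
    refine Finset.mem_filter.2 ⟨hg.1, ?_, fun i hi => hg.2.2 i (by simp [hi])⟩
    rw [hg.2.1 i₀ (by simp), hfv]
  have hupd : (fun i => if i = i₀ then X₀ else X) = Function.update (fun _ => X) i₀ X₀ := by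
    ext i; by_cases h : i = i₀ <;> simp [h]
  have hcnt : X₀.card * D ^ (k - 1) ≤ cnt (FE k E) (fun i => if i = i₀ then X₀ else X) := by
    rw [hupd, cnt_update, ← smul_eq_mul]
    refine Finset.card_nsmul_le_sum _ _ _ (fun v hv => ?_)
    refine le_trans (hX₀ v hv) (le_of_eq ?_)
    congr
  have hprod : ∏ i, (((if i = i₀ then X₀ else X : Finset V)).card : ℝ) =
      X₀.card * (X.card : ℝ) ^ (k - 1) := by
    rw [← Finset.mul_prod_erase univ _ (Finset.mem_univ i₀)]
    simp only [if_true]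
    congr 1
    rw [Finset.prod_congr rfl (g := fun _ => (X.card : ℝ))]
    · simp [Finset.card_erase_of_mem]
    · intro i hi
      rw [if_neg (Finset.ne_of_mem_erase hi)]
  rw [hprod]
  have hXn : (X.card : ℝ) ≤ n := by exact_mod_cast Finset.card_le_univ X
  have hDr : α * n / 2 ≤ D := Nat.le_ceil _
  calc (α / 2) ^ (k - 1) * (X₀.card * (X.card : ℝ) ^ (k - 1))
      = X₀.card * (α / 2 * X.card) ^ (k - 1) := by rw [mul_pow]; ring
    _ ≤ X₀.card * (D : ℝ) ^ (k - 1) := by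
        gcongr
        nlinarith
    _ ≤ _ := by exact_mod_cast hcnt

theorem step_aux {V : Type*} [Fintype V] [DecidableEq V] {k : ℕ} (E : Finset (Finset V))
    (hE : ∀ e ∈ E, e.card = k) (t : ℕ) (ht : 2 ≤ t) (α : ℝ) (hα : 0 < α)
    (hdeg : (1 - 1 / (t : ℝ)) * Fintype.card V + α * Fintype.card V ≤ (posCodeg k E : ℝ))
    (hiso : ∀ v, 1 ≤ degH E {v}) (i₀ : Fin k) (hn : 2 ≤ α * Fintype.card V)
    (ε : ℝ) (hε : 0 < ε) (hε4 : ε ≤ 1 / 4) (N : ℕ)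
    (hN : 1 < (α / 2) ^ (k - 1) * (1 + ε ^ k / 2) ^ N)
    (m₀ : ℕ) (hm₀ : 4 ≤ ε ^ N * m₀) (hm₁ : 1 ≤ m₀) (hm₀t : m₀ ≤ Fintype.card V / t)
    (X₀ X : Finset V) (hX₀ : X₀.card = m₀) (hX : X.card = Fintype.card V / t) (hXX : X₀ ⊆ X) :
    ∃ A : Fin k → Finset V, (∀ B : Fin k → Finset V, (∀ i, B i ⊆ A i) →
        (∀ i, ε * (A i₀).card ≤ (B i).card) →
        (α / 2) ^ (k - 1) / 2 * (ε * (A i₀).card) ^ k ≤ cnt (FE k E) B) ∧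
      (∀ i, (A i).card = (A i₀).card) ∧
      ε ^ N * m₀ ≤ (A i₀).card ∧ A i₀ ⊆ X₀ ∧ ∀ i, A i ⊆ X := by
  have h1 := dense_aux E hE t ht α hα hdeg hiso i₀ hn X₀ X hX
  obtain ⟨A₁, hA1, hA2, hA3⟩ := shrink_aux (FE k E) (fun i => if i = i₀ then X₀ else X) m₀
    (fun i => by
      split_ifs
      · exact hX₀.ge
      · rw [hX]; exact hm₀t) hm₁ _ h1
  obtain ⟨A, m, hB1, hB2, hB3, hB4⟩ := regular_aux (FE k E) ε hε hε4 ((α / 2) ^ (k - 1))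
    (by positivity) N (by simpa using hN) A₁ m₀ hA2 hm₀ hA3
  refine ⟨A, ?_, fun i => by rw [hB2, hB2], ?_, ?_, ?_⟩
  · intro B h2 h3
    rw [hB2] at h3 ⊢
    simpa using hB4 B h2 h3
  · rw [hB2]; exact hB3
  · have := (hB1 i₀).trans (hA1 i₀)
    simpa using this
  · intro i
    refine (hB1 i).trans ((hA1 i).trans ?_)
    split_ifs
    · exact hXX
    · exact subset_rfl

theorem upos_aux {k d : ℕ} (Lam : ℕ) (c : ℕ → Fin k) (hLam : 0 < Lam)
    (hper : ∀ p, c (p + Lam) = c p)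
    (hwin : ∀ a, Set.InjOn c (Set.Ico (a * d) (a * d + k))) (i : Fin k) :
    1 ≤ ((Finset.range Lam).filter (fun p => c p = i)).card := by
  have hinj : Function.Injective (fun p : Fin k => c p) := by
    intro a b hab
    have := hwin 0 (by simp : (a : ℕ) ∈ _) (by simp : (b : ℕ) ∈ _) hab
    exact Fin.ext this
  obtain ⟨p, hp⟩ := (Finite.injective_iff_surjective.1 hinj) i
  have hmod : ∀ q, c (q % Lam) = c q := fun q => by
    have h : Function.Periodic c Lam := hper
    exact h.map_mod_nat q
  refine Finset.card_pos.2 ⟨p % Lam, ?_⟩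
  rw [Finset.mem_filter, Finset.mem_range]
  exact ⟨Nat.mod_lt _ hLam, by rw [hmod]; exact hp⟩

theorem assemble_aux {V : Type*} [Fintype V] [DecidableEq V] {k ℓ : ℕ} (hℓk : ℓ < k)
    (E : Finset (Finset V)) (hE : ∀ e ∈ E, e.card = k)
    (Lam : ℕ) (c : ℕ → Fin k) (hLam : 0 < Lam) (hdvd : (k - ℓ) ∣ Lam)
    (hper : ∀ p, c (p + Lam) = c p)
    (hwin : ∀ a, Set.InjOn c (Set.Ico (a * (k - ℓ)) (a * (k - ℓ) + k)))
    (θ j : ℕ) (hj : 1 ≤ j) (hθ : j * Lam + ℓ ≤ θ) (K : ℕ) (hK : 0 < K) (ε : ℝ) (hε : 0 ≤ ε)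
    (r : ℕ) (A : Fin r → Fin k → Finset V) (m : Fin r → ℕ)
    (hm : ∀ s i, (A s i).card = m s)
    (hgood : ∀ s, ∀ B : Fin k → Finset V, (∀ i, B i ⊆ A s i) → (∀ i, ε * m s ≤ (B i).card) →
      θ * (k * Fintype.card V ^ (k - 1)) < cnt (FE k E) B)
    (u : Fin k → ℕ) (hu : ∀ i, u i = ((Finset.range Lam).filter (fun p => c p = i)).card)
    (hload : ∀ v, ∑ s, tw u (A s) v ≤ K) :
    ∃ P : Finset (List V), (∀ vs ∈ P, IsLPathIn k ℓ E vs) ∧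
      (∀ vs ∈ P, ∀ ws ∈ P, vs ≠ ws → Disjoint vs.toFinset ws.toFinset) ∧
      (∀ vs ∈ P, vs.length = j * Lam + ℓ) ∧
      ∑ s, ((m s : ℝ) / K - 2 ^ (r * k) - ε * m s - m s * ℓ / (j * K) - j) ≤ P.card * j := by
  have hKr : (0 : ℝ) < K := by exact_mod_cast hK
  have hjr : (1 : ℝ) ≤ j := by exact_mod_cast hj
  have hu1 : ∀ i, (1 : ℝ) ≤ u i := fun i => by
    rw [hu]; exact_mod_cast upos_aux Lam c hLam hper hwin i
  obtain ⟨B, hB1, hB2, hB3⟩ := round_aux (I := Fin r × Fin k) (fun x => A x.1 x.2)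
    (fun x => u x.2) K hK (by
      intro v
      refine le_trans (le_of_eq ?_) (hload v)
      rw [Finset.sum_filter, Fintype.sum_prod_type]
      rfl)
  simp only [hm, Fintype.card_prod, Fintype.card_fin] at hB3
  have hP : ∀ s, ∃ P : Finset (List V), ((m s : ℝ) / K - 2 ^ (r * k) - ε * m s - m s * ℓ / (j * K) - j ≤
      P.card * j) ∧ (∀ vs ∈ P, IsLPathIn k ℓ E vs) ∧
        (∀ vs ∈ P, ∀ ws ∈ P, vs ≠ ws → Disjoint vs.toFinset ws.toFinset) ∧
        (∀ vs ∈ P, vs.length = j * Lam + ℓ) ∧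
        (∀ vs ∈ P, vs.toFinset ⊆ univ.biUnion (fun i => B (s, i))) := by
    intro s
    set h : ℝ := (m s : ℝ) / K - 2 ^ (r * k) - ε * m s with hh
    have hdiv : 0 ≤ (m s : ℝ) * ℓ / (j * K) := by positivity
    by_cases hneg : h < 0
    · refine ⟨∅, ?_, by simp, by simp, by simp, by simp⟩
      simp only [Finset.card_empty, Nat.cast_zero, zero_mul]
      linarith
    push Not at hneg
    have hjl : (0 : ℝ) < j + ℓ := by positivity
    have hT := Nat.floor_le (show 0 ≤ h / (j + ℓ) by positivity)
    have hT2 := Nat.lt_floor_add_one (h / (j + ℓ))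
    set T := ⌊h / (j + ℓ)⌋₊ with hTdef
    rw [le_div_iff₀ hjl] at hT
    obtain ⟨P, hP1, hP2, hP3, hP4, hP5⟩ := tile_aux hℓk E hE Lam c hLam hdvd hper hwin θ j hj hθ
      (A s) (ε * m s) (hgood s) T (fun i => B (s, i)) (fun i => hB1 (s, i))
      (fun i i' hii => hB2 _ _ (by simpa using hii)) (by
        intro i
        refine le_trans ?_ (hB3 (s, i))
        rw [← hu]
        have h1 : (T : ℝ) * (j * u i + ℓ) ≤ u i * (T * (j + ℓ)) := by
          have : (0 : ℝ) ≤ T * ℓ := by positivity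
          nlinarith [hu1 i]
        have h2 : ε * m s ≤ u i * (ε * m s) := by
          have : (0 : ℝ) ≤ ε * m s := by positivity
          nlinarith [hu1 i]
        have h3 : (u i : ℝ) * (T * (j + ℓ)) ≤ u i * h := by gcongr
        have h4 : (u i : ℝ) * h = u i * ((m s : ℝ) / K - 2 ^ (r * k)) - u i * (ε * m s) := by
          rw [hh]; ring
        linarith)
    refine ⟨P, ?_, hP2, hP3, hP4, hP5⟩
    rw [hP1]
    rw [div_lt_iff₀ hjl] at hT2
    -- h < (T+1)(j+ℓ)
    have h5 : h * j / (j + ℓ) < (T + 1) * j := by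
      rw [div_lt_iff₀ hjl]
      nlinarith
    have h6 : h - m s * ℓ / (j * K) ≤ h * j / (j + ℓ) := by
      rw [le_div_iff₀ hjl]
      have h7 : h ≤ m s / K := by
        have : (0 : ℝ) ≤ ε * m s := by positivity
        have : (0 : ℝ) ≤ 2 ^ (r * k) := by positivity
        linarith
      have h8 : (m s : ℝ) * ℓ / (j * K) * (j + ℓ) = (m s / K) * ℓ + m s * ℓ / (j * K) * ℓ := by
        field_simp
      have h9 : 0 ≤ (m s : ℝ) * ℓ / (j * K) * ℓ := by positivity
      have h10 : h * ℓ ≤ m s / K * ℓ := by gcongr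
      rw [sub_mul, h8]
      linarith
    linarith
  choose P hP1 hP2 hP3 hP4 hP5 using hP
  have hcross : ∀ s s', s ≠ s' → ∀ vs ∈ P s, ∀ ws ∈ P s', Disjoint vs.toFinset ws.toFinset := by
    intro s s' hss vs hvs ws hws
    refine Finset.disjoint_of_subset_left (hP5 s vs hvs)
      (Finset.disjoint_of_subset_right (hP5 s' ws hws) ?_)
    rw [Finset.disjoint_biUnion_left]
    intro i _
    rw [Finset.disjoint_biUnion_right]
    intro i' _
    exact hB2 _ _ (by simp [hss])
  refine ⟨univ.biUnion P, ?_, ?_, ?_, ?_⟩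
  · intro vs hvs
    obtain ⟨s, -, h⟩ := Finset.mem_biUnion.1 hvs
    exact hP2 s vs h
  · intro vs hvs ws hws hne
    obtain ⟨s, -, h⟩ := Finset.mem_biUnion.1 hvs
    obtain ⟨s', -, h'⟩ := Finset.mem_biUnion.1 hws
    by_cases hss : s = s'
    · subst hss; exact hP3 s vs h ws h' hne
    · exact hcross s s' hss vs h ws h'
  · intro vs hvs
    obtain ⟨s, -, h⟩ := Finset.mem_biUnion.1 hvs
    exact hP4 s vs h
  · rw [Finset.card_biUnion]
    · push_cast
      rw [Finset.sum_mul]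
      exact Finset.sum_le_sum (fun s _ => hP1 s)
    · intro s _ s' _ hss
      rw [Function.onFun, Finset.disjoint_left]
      intro vs h h'
      have h1 := hcross s s' hss vs h vs h'
      rw [Finset.disjoint_self_iff_empty, List.toFinset_eq_empty_iff] at h1
      have h2 := hP4 s vs h
      rw [h1] at h2
      have : 0 < j * Lam := by positivity
      simp at h2
      omega

theorem ev_aux (a b : ℝ) (hb : 0 < b) : ∀ᶠ n : ℕ in Filter.atTop, a ≤ b * n := by
  filter_upwards [Filter.eventually_ge_atTop ⌈a / b⌉₊] with n hn
  have := (Nat.ceil_le.1 hn)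
  rw [div_le_iff₀ hb] at this
  linarith

theorem cover_aux {V : Type*} [DecidableEq V] {k ℓ : ℕ} (E : Finset (Finset V)) (len : ℕ)
    (P : Finset (List V)) (h1 : ∀ vs ∈ P, IsLPathIn k ℓ E vs)
    (h2 : ∀ vs ∈ P, ∀ ws ∈ P, vs ≠ ws → Disjoint vs.toFinset ws.toFinset)
    (h3 : ∀ vs ∈ P, vs.length = len) :
    (P.biUnion (fun vs => vs.toFinset)).card = P.card * len := by
  rw [Finset.card_biUnion (fun vs hvs ws hws h => h2 vs hvs ws hws h)]
  rw [Finset.sum_congr rfl (g := fun _ => len)]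
  · simp
  · intro vs hvs
    rw [List.toFinset_card_of_nodup (h1 vs hvs).1, h3 vs hvs]

set_option maxHeartbeats 2000000 in
theorem main_aux (k ℓ : ℕ) (hℓ1 : 1 ≤ ℓ) (hℓk : ℓ < k)
    (α β : ℝ) (hα : 0 < α) (hβ : 0 < β) :
      ∃ M n₀ : ℕ, ∀ n : ℕ, n₀ ≤ n →
        ∀ E : Finset (Finset (Fin n)), (∀ e ∈ E, e.card = k) →
          (1 - 1 / ((k / (k - ℓ) * (k - ℓ) : ℕ) : ℝ)) * n + α * n ≤ (posCodeg k E : ℝ) →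
          (∀ v : Fin n, 1 ≤ degH E {v}) →
          ∃ Paths : Finset (List (Fin n)), Paths.card ≤ M ∧
            (∀ vs ∈ Paths, IsLPathIn k ℓ E vs) ∧
            (∀ vs ∈ Paths, ∀ ws ∈ Paths, vs ≠ ws → Disjoint vs.toFinset ws.toFinset) ∧
            (1 - β) * n ≤ ((Paths.biUnion (fun vs => vs.toFinset)).card : ℝ) := by
  obtain ⟨Lam, c, i₀, hLam, hdvd, hper, hwin, hi₀⟩ := pattern_aux k (k - ℓ) (by omega) (by omega)
  set t := k / (k - ℓ) * (k - ℓ) with ht_def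
  have ht : 2 ≤ t := by
    have h1 := Nat.div_add_mod k (k - ℓ)
    have h2 := Nat.mod_lt k (show 0 < k - ℓ by omega)
    rw [mul_comm] at h1
    omega
  obtain ⟨u, hu⟩ : ∃ u : Fin k → ℕ, ∀ i, u i =
    ((Finset.range Lam).filter (fun p => c p = i)).card := ⟨_, fun _ => rfl⟩
  have hsumu : ∑ i, u i = Lam := by
    simp only [hu]
    rw [← Finset.card_eq_sum_card_fiberwise (fun _ _ => Finset.mem_coe.2 (Finset.mem_univ _)),
      Finset.card_range]
  rw [← hu] at hi₀
  have hui₀ : 0 < u i₀ := by rw [hu]; exact upos_aux Lam c hLam hper hwin i₀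
  have hLr : (0 : ℝ) < Lam := by exact_mod_cast hLam
  have htr : (0 : ℝ) < t := by positivity
  have hkr : (0 : ℝ) < k := by exact_mod_cast (by omega : 0 < k)
  have hℓr : (0 : ℝ) < ℓ := by exact_mod_cast hℓ1
  -- constants
  obtain ⟨K, hKgt⟩ := exists_nat_gt (4 * Lam / β + 128 * Lam / β ^ 2)
  have hKp1 : 0 < 4 * Lam / β := by positivity
  have hKp2 : 0 < 128 * Lam / β ^ 2 := by positivity
  have hKr : (0 : ℝ) < K := by linarith
  have hK : 0 < K := by exact_mod_cast hKr
  have hK1 : (Lam : ℝ) ≤ β / 4 * K := by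
    have : 4 * Lam / β ≤ K := by linarith
    rw [div_le_iff₀ hβ] at this
    linarith
  have hK2 : (Lam : ℝ) / K ≤ β ^ 2 / 128 := by
    have : 128 * Lam / β ^ 2 ≤ K := by linarith
    rw [div_le_iff₀ (by positivity)] at this
    rw [div_le_iff₀ hKr]
    linarith
  obtain ⟨κ, hκ0, hκ1, hκ2⟩ : ∃ κ : ℝ, 0 < κ ∧ κ ≤ β ^ 2 / 256 ∧ κ ≤ 1 / t :=
    ⟨min (β ^ 2 / 256) (1 / t), by positivity, min_le_left _ _, min_le_right _ _⟩
  obtain ⟨ε, hε0, hε4, hεK⟩ : ∃ ε : ℝ, 0 < ε ∧ ε ≤ 1 / 4 ∧ ε ≤ β / (8 * K) :=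
    ⟨min (1 / 4) (β / (8 * K)), by positivity, min_le_left _ _, min_le_right _ _⟩
  obtain ⟨ρ, hρ⟩ : ∃ ρ : ℝ, ρ = (α / 2) ^ (k - 1) := ⟨_, rfl⟩
  have hρ0 : 0 < ρ := by rw [hρ]; positivity
  obtain ⟨N, hN⟩ : ∃ N : ℕ, 1 < ρ * (1 + ε ^ k / 2) ^ N := by
    obtain ⟨N, hN⟩ := pow_unbounded_of_one_lt (1 / ρ) (show 1 < 1 + ε ^ k / 2 by
      have : 0 < ε ^ k := by positivity
      linarith)
    refine ⟨N, ?_⟩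
    rw [div_lt_iff₀ hρ0] at hN
    linarith
  obtain ⟨γ, hγ⟩ : ∃ γ : ℝ, γ = ε ^ N * κ / 2 := ⟨_, rfl⟩
  have hγ0 : 0 < γ := by rw [hγ]; positivity
  obtain ⟨C, hC⟩ : ∃ C : ℝ, C = ρ / 2 * (ε * γ) ^ k := ⟨_, rfl⟩
  have hC0 : 0 < C := by rw [hC]; positivity
  obtain ⟨R, hR⟩ : ∃ R : ℕ, (K : ℝ) / (γ * Lam) < R := exists_nat_gt _
  have hR0 : (0 : ℝ) < R := lt_trans (by positivity) hR
  obtain ⟨c', hc0, hc1, hc2⟩ : ∃ c' : ℝ, 0 < c' ∧ c' ≤ β / (8 * Lam * R) ∧ c' ≤ C / (4 * Lam * k) :=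
    ⟨min (β / (8 * Lam * R)) (C / (4 * Lam * k)), by positivity, min_le_left _ _, min_le_right _ _⟩
  obtain ⟨n₀, hn₀⟩ := Filter.eventually_atTop.1 ((ev_aux 2 α hα).and ((ev_aux 2 κ hκ0).and
    ((ev_aux 4 γ hγ0).and ((ev_aux (ℓ * k + ℓ * k) C hC0).and ((ev_aux 2 c' hc0).and
    ((ev_aux (16 * ℓ) (c' * β) (by positivity)).and
    ((ev_aux (8 * (Lam * R * 2 ^ (R * k))) β hβ).and (Filter.eventually_ge_atTop 1))))))))
  refine ⟨⌈2 / c'⌉₊, n₀, fun n hn E hE hdeg hiso => ?_⟩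
  obtain ⟨e1, e2, e3, e4, e5, e6, e7, e8⟩ := hn₀ n hn
  have hnr : (1 : ℝ) ≤ n := by exact_mod_cast e8
  have hcardV : Fintype.card (Fin n) = n := Fintype.card_fin n
  -- m₀
  obtain ⟨m₀, hm1, hm2⟩ : ∃ m₀ : ℕ, (m₀ : ℝ) ≤ κ * n ∧ κ * n / 2 ≤ m₀ :=
    ⟨⌊κ * n⌋₊, Nat.floor_le (by positivity), by
      have := Nat.lt_floor_add_one (κ * n)
      linarith⟩
  have hm₀1 : 1 ≤ m₀ := by
    have : (1 : ℝ) ≤ m₀ := by linarith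
    exact_mod_cast this
  have hm₀t : m₀ ≤ n / t := by
    rw [Nat.le_div_iff_mul_le (by omega)]
    have h1 : (m₀ : ℝ) * t ≤ n := by
      have h2 : κ * t ≤ 1 := by
        rw [le_div_iff₀ htr] at hκ2; exact hκ2
      nlinarith
    exact_mod_cast h1
  have hεm : γ * n ≤ ε ^ N * m₀ := by
    rw [hγ]
    have := mul_le_mul_of_nonneg_left hm2 (show 0 ≤ ε ^ N by positivity)
    linarith
  -- j
  obtain ⟨j, hj1, hj2⟩ : ∃ j : ℕ, (j : ℝ) ≤ c' * n ∧ c' * n / 2 ≤ j :=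
    ⟨⌊c' * n⌋₊, Nat.floor_le (by positivity), by
      have := Nat.lt_floor_add_one (c' * n)
      linarith⟩
  have hjr : (1 : ℝ) ≤ j := by linarith
  have hj : 1 ≤ j := by exact_mod_cast hjr
  obtain ⟨θ, hθ⟩ : ∃ θ : ℕ, θ = j * Lam + ℓ := ⟨_, rfl⟩
  have hθC : ((θ * (k * n ^ (k - 1)) : ℕ) : ℝ) < C * n ^ k := by
    have h1 : (θ : ℝ) * k < C * n := by
      rw [hθ]; push_cast
      have h2 : (j : ℝ) * Lam * k ≤ C * n / 4 := by
        rw [le_div_iff₀ (by positivity)] at hc2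
        have h3 : (j : ℝ) * (Lam * k) ≤ c' * n * (Lam * k) := by gcongr
        nlinarith
      have : 0 < C * n := by positivity
      nlinarith
    have h2 : (n : ℝ) ^ k = n * n ^ (k - 1) := by
      rw [← pow_succ']; congr 1; omega
    rw [h2]; push_cast
    have h3 : (0 : ℝ) < n ^ (k - 1) := by positivity
    nlinarith
  let Good : (Fin k → Finset (Fin n)) → Prop := fun A => ∀ B : Fin k → Finset (Fin n),
    (∀ i, B i ⊆ A i) → (∀ i, ε * (A i₀).card ≤ (B i).card) →
      θ * (k * Fintype.card (Fin n) ^ (k - 1)) < cnt (FE k E) B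
  obtain ⟨L, hL1, hL2, hL3, hL4, hL5⟩ := process_aux (V := Fin n) u i₀ t K m₀ κ β γ ht
    (by rw [hsumu]; exact hi₀) hui₀ (by rw [hcardV]; exact e8) hβ hK hγ0 hκ0.le
    (by rw [hcardV]; exact hm1) hm₀1 (by rw [hcardV]; exact hm₀t) (by rw [hsumu]; exact hK1)
    (by
      rw [hsumu]
      have : 0 < β ^ 2 := by positivity
      linarith) Good (by
      intro X₀ X hXX hX₀ hX
      obtain ⟨A, hA1, hA2, hA3, hA4, hA5⟩ := step_aux E hE t ht α hα (by rw [hcardV]; exact hdeg)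
        hiso i₀ (by rw [hcardV]; exact e1) ε hε0 hε4 N (by rw [← hρ]; exact hN) m₀
        (by linarith) hm₀1 (by rw [hcardV]; exact hm₀t) X₀ X hX₀ hX hXX
      have hmγ : γ * n ≤ (A i₀).card := hεm.trans hA3
      refine ⟨A, ?_, hA2, by rw [hcardV]; exact hmγ, hA4, hA5⟩
      intro B hB1 hB2
      have h1 := hA1 B hB1 hB2
      rw [← hρ] at h1
      have h2 : C * n ^ k ≤ ρ / 2 * (ε * (A i₀).card) ^ k := by
        rw [hC, mul_assoc, ← mul_pow]
        have : ε * γ * n ≤ ε * (A i₀).card := by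
          rw [mul_assoc]; gcongr
        gcongr
      have h3 := lt_of_lt_of_le hθC (h2.trans h1)
      rw [hcardV]
      exact_mod_cast h3)
  rw [hsumu] at hL3 hL4 hL5
  rw [hcardV] at hL4 hL5
  have hloadsum : ∀ v, ∑ s : Fin L.length, tw u (L[s.1]) v = load u L v := by
    intro v
    unfold load
    exact Fin.sum_univ_fun_getElem L (fun A => tw u A v)
  have hmasssum : ∑ s : Fin L.length, (L[s.1] i₀).card = mass i₀ L := by
    unfold mass
    exact Fin.sum_univ_fun_getElem L (fun A => (A i₀).card)
  obtain ⟨P, hP1, hP2, hP3, hP4⟩ := assemble_aux hℓk E hE Lam c hLam hdvd hper hwin θ j hj hθ.ge K hK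
    ε hε0.le L.length (fun s => L[s.1]) (fun s => (L[s.1] i₀).card)
    (fun s i => (hL1 _ (List.getElem_mem s.2)).2 i) (fun s => (hL1 _ (List.getElem_mem s.2)).1) u hu
    (fun v => by rw [hloadsum]; exact hL2 v)
  have hcov := cover_aux E _ P hP1 hP2 hP3
  have hcovn : P.card * (j * Lam + ℓ) ≤ n := by
    rw [← hcov]
    exact (Finset.card_le_univ _).trans hcardV.le
  have hPj : P.card * j ≤ n := by
    refine le_trans ?_ hcovn
    apply Nat.mul_le_mul_left
    nlinarith
  refine ⟨P, ?_, hP1, hP2, ?_⟩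
  · have h1 : (P.card : ℝ) * j ≤ n := by exact_mod_cast hPj
    have h2 : (P.card : ℝ) * (c' * n / 2) ≤ n := 
      le_trans (mul_le_mul_of_nonneg_left hj2 (Nat.cast_nonneg _)) h1
    have h3 : (P.card : ℝ) ≤ 2 / c' := by
      rw [le_div_iff₀ hc0]
      have h4 : n * ((P.card : ℝ) * c') ≤ n * 2 := by linarith
      exact le_of_mul_le_mul_left h4 (by linarith)
    exact_mod_cast h3.trans (Nat.le_ceil _)
  · rw [hcov]
    obtain ⟨r, hr⟩ : ∃ r : ℕ, r = L.length := ⟨_, rfl⟩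
    obtain ⟨Ms, hMs⟩ : ∃ Ms : ℝ, Ms = mass i₀ L := ⟨_, rfl⟩
    have hMs0 : 0 ≤ Ms := by rw [hMs]; positivity
    have hsum : ∑ s : Fin L.length, (((L[s.1] i₀).card : ℝ) / K - 2 ^ (L.length * k) -
        ε * (L[s.1] i₀).card - (L[s.1] i₀).card * ℓ / (j * K) - j) =
        Ms / K - ε * Ms - Ms * ℓ / (j * K) - r * 2 ^ (r * k) - r * j := by
      rw [hMs, ← hmasssum, hr]
      push_cast
      simp only [Finset.sum_sub_distrib, Finset.sum_div, Finset.mul_sum, Finset.sum_mul,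
        Finset.sum_const, Finset.card_univ, Fintype.card_fin, nsmul_eq_mul]
      ring
    rw [hsum] at hP4
    rw [← hMs] at hL4 hL5
    rw [← hr] at hL3
    have hrR : (r : ℝ) ≤ R := by
      refine le_trans ?_ hR.le
      rw [le_div_iff₀ (by positivity)]
      linarith
    have hrR' : r ≤ R := by exact_mod_cast hrR
    have hP5 := mul_le_mul_of_nonneg_left hP4 hLr.le
    have l1 : (1 - β / 2) * n ≤ Lam * (Ms / K) := by
      rw [← mul_div_assoc, le_div_iff₀ hKr]; exact hL5
    have hMK : Lam * (Ms / K) ≤ n := by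
      rw [← mul_div_assoc, div_le_iff₀ hKr]; exact hL4
    have l2 : Lam * (ε * Ms) ≤ β * n / 8 := by
      have h1 : ε * (Lam * Ms) ≤ β / (8 * K) * (n * K) := by gcongr
      have h2 : β / (8 * K) * (n * K) = β * n / 8 := by field_simp
      linarith
    have l3 : Lam * (Ms * ℓ / (j * K)) ≤ β * n / 8 := by
      have h1 : Lam * (Ms * ℓ / (j * K)) = Lam * (Ms / K) * (ℓ / j) := by field_simp
      have h2 : (ℓ : ℝ) / j ≤ β / 8 := by
        rw [div_le_iff₀ (by linarith)]
        nlinarith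
      rw [h1]
      calc Lam * (Ms / K) * ((ℓ : ℝ) / j) ≤ n * (β / 8) := by gcongr
        _ = _ := by ring
    have l4 : (Lam : ℝ) * (r * 2 ^ (r * k)) ≤ β * n / 8 := by
      have h1 : (Lam : ℝ) * (r * 2 ^ (r * k)) ≤ Lam * (R * 2 ^ (R * k)) := by
        gcongr
        norm_num
      linarith
    have l5 : (Lam : ℝ) * (r * j) ≤ β * n / 8 := by
      have h1 : (Lam : ℝ) * (r * j) ≤ Lam * (R * (c' * n)) := by gcongr
      rw [le_div_iff₀ (by positivity)] at hc1
      nlinarith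
    have h6 : (Lam : ℝ) * (P.card * j) ≤ ((P.card * (j * Lam + ℓ) : ℕ) : ℝ) := by
      push_cast
      have : (0 : ℝ) ≤ P.card * ℓ := mul_nonneg (Nat.cast_nonneg _) hℓr.le
      linarith
    refine le_trans ?_ h6
    refine le_trans ?_ hP5
    linarith

/-- Lemma 2.3, path tiling lemma: for sufficiently small `α, β > 0`,
under `δ⁺(H) ≥ (1 - 1/(⌊k/(k-ℓ)⌋(k-ℓ)))n + αn` and no isolated vertices, there are at
most `M` pairwise vertex-disjoint `ℓ`-paths in `H` covering at least `(1-β)n` vertices. -/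
theorem statement12 (k ℓ : ℕ) (hk : 3 ≤ k) (hℓ1 : 1 ≤ ℓ) (hℓ2 : ℓ ≤ k - 1) :
    ∃ c₀ : ℝ, 0 < c₀ ∧ ∀ α β : ℝ, 0 < α → α < c₀ → 0 < β → β < c₀ →
      ∃ M n₀ : ℕ, ∀ n : ℕ, n₀ ≤ n →
        ∀ E : Finset (Finset (Fin n)), (∀ e ∈ E, e.card = k) →
          (1 - 1 / ((k / (k - ℓ) * (k - ℓ) : ℕ) : ℝ)) * n + α * n ≤ (posCodeg k E : ℝ) →
          (∀ v : Fin n, 1 ≤ degH E {v}) →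
          ∃ Paths : Finset (List (Fin n)), Paths.card ≤ M ∧
            (∀ vs ∈ Paths, IsLPathIn k ℓ E vs) ∧
            (∀ vs ∈ Paths, ∀ ws ∈ Paths, vs ≠ ws → Disjoint vs.toFinset ws.toFinset) ∧
            (1 - β) * n ≤ ((Paths.biUnion (fun vs => vs.toFinset)).card : ℝ) := by
  refine ⟨1, one_pos, fun α β hα _ hβ _ => ?_⟩
  exact main_aux k ℓ hℓ1 (by omega) α β hα hβ
end
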